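/- There is a polynomial P_4 with real coefficients of degree 5 such that for every ε > 0, N_4(B) = B · P_4(log B) + O_ε(B^{11/12 + ε}) as B → ∞; i.e., for each ε > 0 there is C(ε) > 0 with |N_4(B) − B·P_4(log B)| ≤ C(ε) · B^{11/12 + ε} for all large B. -/

import Mathlib

/-- `N_d(B)`: the number of orders of `ℤ^d` (unital subrings of the ring `Fin d → ℤ`
with componentwise operations, of finite additive index) whose additive index is at
most `B`. -/
noncomputable def numOrdersZ (d : ℕ) (B : ℝ) : ℕ :=
  Nat.card {O : Subring (Fin d → ℤ) //
    O.toAddSubgroup.index ≠ 0 ∧ (O.toAddSubgroup.index : ℝ) ≤ B}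

section Multiplicativity

variable {R : Type*} [CommRing R]

/-- The number of subrings of `R` of additive index `n`. -/
noncomputable def subringCount (R : Type*) [CommRing R] (n : ℕ) : ℕ :=
  Nat.card {S : Subring R // S.toAddSubgroup.index = n}

theorem nsmul_mem_of_index {S : Subring R} {n : ℕ} (h : S.toAddSubgroup.index = n) (x : R) :
    (n : R) * x ∈ S := by
  have := S.toAddSubgroup.nsmul_index_mem x
  rw [h, nsmul_eq_mul] at this
  exact this

/-- For `S` containing `mnR` with `m`, `n` coprime, this is the subring `S + mR`. -/
def Subring.primaryPart (S : Subring R) (m n : ℕ) (hmn : m.Coprime n)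
    (h : ∀ x : R, ((m * n : ℕ) : R) * x ∈ S) : Subring R where
  carrier := {x | (n : R) * x ∈ S}
  one_mem' := by
    change (n : R) * 1 ∈ S
    rw [mul_one]; exact natCast_mem S n
  zero_mem' := by simp
  add_mem' {x y} hx hy := by
    change (n : R) * (x + y) ∈ S
    rw [mul_add]; exact S.add_mem hx hy
  neg_mem' {x} hx := by
    change (n : R) * (-x) ∈ S
    rw [mul_neg]; exact S.neg_mem hx
  mul_mem' {x y} hx hy := by
    change (n : R) * (x * y) ∈ S
    have hb : (m : ℤ) * m.gcdA n + n * m.gcdB n = 1 := by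
      rw [← Nat.gcd_eq_gcd_ab, hmn.gcd_eq_one]; rfl
    have hb' : (m : R) * (m.gcdA n : R) + n * (m.gcdB n : R) = 1 := by
      exact_mod_cast congrArg (Int.cast : ℤ → R) hb
    have e : (n : R) * (x * y) =
        ((m * n : ℕ) : R) * ((m.gcdA n : R) * (x * y))
          + (m.gcdB n : R) * (((n : R) * x) * ((n : R) * y)) := by
      push_cast
      linear_combination (-(n : R) * (x * y)) * hb'
    rw [e]
    exact S.add_mem (h _) (S.mul_mem (intCast_mem S _) (S.mul_mem hx hy))

theorem mem_of_coprime_mul_mem {S : Subring R} {m n : ℕ} (hmn : m.Coprime n) {x : R}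
    (hm : (m : R) * x ∈ S) (hn : (n : R) * x ∈ S) : x ∈ S := by
  have hb : (m : ℤ) * m.gcdA n + n * m.gcdB n = 1 := by
    rw [← Nat.gcd_eq_gcd_ab, hmn.gcd_eq_one]; rfl
  have hb' : (m : R) * (m.gcdA n : R) + n * (m.gcdB n : R) = 1 := by
      exact_mod_cast congrArg (Int.cast : ℤ → R) hb
  have e : x = (m.gcdA n : R) * ((m : R) * x) + (m.gcdB n : R) * ((n : R) * x) := by
    linear_combination (-x) * hb'
  rw [e]
  exact S.add_mem (S.mul_mem (intCast_mem S _) hm) (S.mul_mem (intCast_mem S _) hn)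

/-- If the quotient by `H` is killed by `m`, the index of `H` is coprime to everything coprime
to `m`. -/
theorem AddSubgroup.index_coprime_of_nsmul_mem {G : Type*} [AddCommGroup G] {H : AddSubgroup G}
    {m n : ℕ} (h0 : H.index ≠ 0) (hm : ∀ x, m • x ∈ H) (hmn : m.Coprime n) :
    H.index.Coprime n := by
  refine Nat.Coprime.symm (Nat.coprime_of_dvd fun p hp hpn hpi => ?_)
  have : Finite (G ⧸ H) := by
    have : H.FiniteIndex := ⟨h0⟩
    exact AddSubgroup.finite_quotient_of_finiteIndex
  have : Fact p.Prime := ⟨hp⟩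
  obtain ⟨x, hx⟩ := exists_prime_addOrderOf_dvd_card' p (show p ∣ Nat.card (G ⧸ H) from hpi)
  obtain ⟨y, rfl⟩ := QuotientAddGroup.mk_surjective x
  have : m • (y : G ⧸ H) = 0 := by
    rw [← QuotientAddGroup.mk_nsmul, QuotientAddGroup.eq_zero_iff]; exact hm y
  have hpm : p ∣ m := hx ▸ addOrderOf_dvd_of_nsmul_eq_zero this
  exact hp.one_lt.ne' (Nat.eq_one_of_dvd_one (hmn ▸ Nat.dvd_gcd hpm hpn))

theorem subringCount_mul {m n : ℕ} (hm : m ≠ 0) (hn : n ≠ 0) (hmn : m.Coprime n) :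
    subringCount R (m * n) = subringCount R m * subringCount R n := by
  unfold subringCount
  rw [← Nat.card_prod]
  have key : ∀ S : Subring R, S.toAddSubgroup.index = m * n → ∀ x : R, ((m * n : ℕ) : R) * x ∈ S :=
    fun S hS x => nsmul_mem_of_index hS x
  have key' : ∀ S : Subring R, S.toAddSubgroup.index = m * n → ∀ x : R, ((n * m : ℕ) : R) * x ∈ S :=
    fun S hS x => by rw [mul_comm n m]; exact key S hS x
  have hidx : ∀ (S : Subring R) (hS : S.toAddSubgroup.index = m * n),
      (S.primaryPart m n hmn (key S hS)).toAddSubgroup.index = m ∧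
      (S.primaryPart n m hmn.symm (key' S hS)).toAddSubgroup.index = n := by
    intro S hS
    set A := S.primaryPart m n hmn (key S hS) with hA
    set B := S.primaryPart n m hmn.symm (key' S hS) with hB
    have hSA : S.toAddSubgroup ≤ A.toAddSubgroup := fun x hx => S.mul_mem (natCast_mem S n) hx
    have hSB : S.toAddSubgroup ≤ B.toAddSubgroup := fun x hx => S.mul_mem (natCast_mem S m) hx
    have hAd : A.toAddSubgroup.index ∣ m * n := hS ▸ AddSubgroup.index_dvd_of_le hSA
    have hBd : B.toAddSubgroup.index ∣ m * n := hS ▸ AddSubgroup.index_dvd_of_le hSB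
    have hmn0 : m * n ≠ 0 := mul_ne_zero hm hn
    have hA0 := ne_zero_of_dvd_ne_zero hmn0 hAd
    have hB0 := ne_zero_of_dvd_ne_zero hmn0 hBd
    have hA1 : A.toAddSubgroup.index ∣ m := by
      refine Nat.Coprime.dvd_of_dvd_mul_right
        (AddSubgroup.index_coprime_of_nsmul_mem hA0 (m := m) (fun x => ?_) hmn) hAd
      rw [nsmul_eq_mul]
      change (n : R) * (m * x) ∈ S
      have := key' S hS x
      rwa [Nat.cast_mul, mul_assoc] at this
    have hB1 : B.toAddSubgroup.index ∣ n := by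
      refine Nat.Coprime.dvd_of_dvd_mul_left
        (AddSubgroup.index_coprime_of_nsmul_mem hB0 (m := n) (fun x => ?_) hmn.symm) hBd
      rw [nsmul_eq_mul]
      change (m : R) * (n * x) ∈ S
      have := key S hS x
      rwa [Nat.cast_mul, mul_assoc] at this
    have hle : m * n ≤ A.toAddSubgroup.index * B.toAddSubgroup.index := by
      have h1 : S.toAddSubgroup = A.toAddSubgroup ⊓ B.toAddSubgroup :=
        le_antisymm (le_inf hSA hSB) fun x hx => mem_of_coprime_mul_mem hmn hx.2 hx.1
      rw [← hS, h1]
      exact AddSubgroup.index_inf_le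
    have hAm := Nat.le_of_dvd (Nat.pos_of_ne_zero hm) hA1
    have hBn := Nat.le_of_dvd (Nat.pos_of_ne_zero hn) hB1
    constructor
    · by_contra hne
      have : A.toAddSubgroup.index < m := lt_of_le_of_ne hAm hne
      have := Nat.mul_lt_mul_of_lt_of_le this hBn (Nat.pos_of_ne_zero hn)
      omega
    · by_contra hne
      have : B.toAddSubgroup.index < n := lt_of_le_of_ne hBn hne
      have := Nat.mul_lt_mul_of_le_of_lt hAm this (Nat.pos_of_ne_zero hm)
      omega
  refine Nat.card_congr
    { toFun := fun S => (⟨_, (hidx S.1 S.2).1⟩, ⟨_, (hidx S.1 S.2).2⟩)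
      invFun := fun P => ⟨P.1.1 ⊓ P.2.1, ?_⟩
      left_inv := ?_
      right_inv := ?_ }
  · have e : (P.1.1 ⊓ P.2.1).toAddSubgroup = P.1.1.toAddSubgroup ⊓ P.2.1.toAddSubgroup := rfl
    have h1 : m ∣ (P.1.1 ⊓ P.2.1).toAddSubgroup.index := by
      conv_lhs => rw [← P.1.2]
      exact AddSubgroup.index_dvd_of_le (e ▸ inf_le_left)
    have h2 : n ∣ (P.1.1 ⊓ P.2.1).toAddSubgroup.index := by
      conv_lhs => rw [← P.2.2]
      exact AddSubgroup.index_dvd_of_le (e ▸ inf_le_right)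
    have h3 : (P.1.1 ⊓ P.2.1).toAddSubgroup.index ≤ m * n := by
      rw [e]
      refine AddSubgroup.index_inf_le.trans ?_
      rw [P.1.2, P.2.2]
    have h0 : (P.1.1 ⊓ P.2.1).toAddSubgroup.index ≠ 0 := by
      rw [e]
      exact AddSubgroup.index_inf_ne_zero (by rwa [P.1.2]) (by rwa [P.2.2])
    exact le_antisymm h3 (Nat.le_of_dvd (Nat.pos_of_ne_zero h0) (hmn.mul_dvd_of_dvd_of_dvd h1 h2))
  · rintro ⟨S, hS⟩
    refine Subtype.ext (SetLike.ext fun x => ⟨fun hx => mem_of_coprime_mul_mem hmn hx.2 hx.1,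
      fun hx => ⟨S.mul_mem (natCast_mem S n) hx, S.mul_mem (natCast_mem S m) hx⟩⟩)
  · rintro ⟨⟨A, hA⟩, ⟨B, hB⟩⟩
    refine Prod.ext (Subtype.ext (SetLike.ext fun x => ⟨fun hx => ?_, fun hx => ?_⟩))
      (Subtype.ext (SetLike.ext fun x => ⟨fun hx => ?_, fun hx => ?_⟩))
    · exact mem_of_coprime_mul_mem hmn (nsmul_mem_of_index hA x) hx.1
    · exact ⟨A.mul_mem (natCast_mem A n) hx, nsmul_mem_of_index hB x⟩
    · exact mem_of_coprime_mul_mem hmn hx.2 (nsmul_mem_of_index hB x)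
    · exact ⟨nsmul_mem_of_index hA x, B.mul_mem (natCast_mem B m) hx⟩

theorem subringCount_one : subringCount R 1 = 1 := by
  unfold subringCount
  rw [Nat.card_eq_one_iff_unique]
  refine ⟨⟨fun S T => ?_⟩, ⟨⟨⊤, AddSubgroup.index_top⟩⟩⟩
  have h : ∀ S : {S : Subring R // S.toAddSubgroup.index = 1}, ∀ x, x ∈ S.1 := fun S x => by
    have := AddSubgroup.index_eq_one.1 S.2
    have hx : x ∈ S.1.toAddSubgroup := this ▸ AddSubgroup.mem_top x
    exact hx
  exact Subtype.ext (SetLike.ext fun x => ⟨fun _ => h T x, fun _ => h S x⟩)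

end Multiplicativity

section PrimeIndex

/-- The order of vectors whose coordinates `i` and `j` agree modulo `p`. -/
def congruenceOrder (d p : ℕ) (i j : Fin d) : Subring (Fin d → ℤ) :=
  RingHom.eqLocus ((Int.castRingHom (ZMod p)).comp (Pi.evalRingHom (fun _ : Fin d => ℤ) i))
    ((Int.castRingHom (ZMod p)).comp (Pi.evalRingHom (fun _ : Fin d => ℤ) j))

theorem mem_congruenceOrder {d p : ℕ} {i j : Fin d} {x : Fin d → ℤ} :
    x ∈ congruenceOrder d p i j ↔ (p : ℤ) ∣ x i - x j := by
  have : x ∈ congruenceOrder d p i j ↔ ((x i : ℤ) : ZMod p) = ((x j : ℤ) : ZMod p) := Iff.rfl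
  rw [this, ← ZMod.intCast_zmod_eq_zero_iff_dvd, Int.cast_sub, sub_eq_zero]

theorem index_congruenceOrder {d p : ℕ} {i j : Fin d} (hij : i ≠ j) :
    (congruenceOrder d p i j).toAddSubgroup.index = p := by
  let φ : (Fin d → ℤ) →+ ZMod p :=
    ((Int.castAddHom (ZMod p)).comp (Pi.evalAddMonoidHom (fun _ : Fin d => ℤ) i)) -
    ((Int.castAddHom (ZMod p)).comp (Pi.evalAddMonoidHom (fun _ : Fin d => ℤ) j))
  have hφ : ∀ x, φ x = ((x i : ℤ) : ZMod p) - ((x j : ℤ) : ZMod p) := fun x => rfl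
  have hker : (congruenceOrder d p i j).toAddSubgroup = φ.ker := by
    ext x
    rw [AddMonoidHom.mem_ker, hφ, sub_eq_zero]
    exact Iff.rfl
  have hsurj : Function.Surjective φ := fun z => by
    obtain ⟨a, rfl⟩ := ZMod.intCast_surjective z
    refine ⟨Pi.single i a, ?_⟩
    rw [hφ, Pi.single_eq_same, Pi.single_eq_of_ne hij.symm]
    simp
  rw [hker, AddSubgroup.index_ker, AddMonoidHom.range_eq_top.2 hsurj, AddSubgroup.card_top,
    Nat.card_zmod]

/-- A subring of index `p` is contained in one of the orders cut out by a single congruence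
between two coordinates. -/
theorem exists_eq_congruenceOrder {d p : ℕ} (hp : p.Prime) {S : Subring (Fin d → ℤ)}
    (hS : S.toAddSubgroup.index = p) : ∃ i j : Fin d, i < j ∧ S = congruenceOrder d p i j := by
  obtain ⟨i, j, hij, hle⟩ : ∃ i j : Fin d, i ≠ j ∧ ∀ x ∈ S, (p : ℤ) ∣ x i - x j := by
    by_contra! hcon
    choose s hsS hs using hcon
    have hpS : ∀ x : Fin d → ℤ, (p : ℤ) • x ∈ S := fun x => by
      have := S.toAddSubgroup.nsmul_index_mem x
      rw [hS, ← natCast_zsmul] at this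
      exact this
    have hsingle : ∀ i : Fin d, Pi.single i (1 : ℤ) ∈ S := by
      intro i
      let u : Fin d → ℤ := ∏ j : {j : Fin d // i ≠ j},
        (s i j j.2 - ((s i j j.2 j : ℤ) : Fin d → ℤ))
      have huS : u ∈ S := S.prod_mem fun j _ => S.sub_mem (hsS _ _ _) (intCast_mem S _)
      have hui : u = Pi.single i (u i) := by
        ext k
        by_cases hk : i = k
        · subst hk; simp
        · rw [Pi.single_eq_of_ne (Ne.symm hk)]
          simp only [u, Finset.prod_apply]
          refine Finset.prod_eq_zero (Finset.mem_univ ⟨k, hk⟩) ?_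
          simp
      have hpu : ¬ (p : ℤ) ∣ u i := by
        simp only [u, Finset.prod_apply]
        rw [(Nat.prime_iff_prime_int.1 hp).dvd_finsetProd_iff]
        rintro ⟨j, -, hj⟩
        exact hs i j j.2 (by simpa using hj)
      have hcop : IsCoprime (p : ℤ) (u i) :=
        (Nat.prime_iff_prime_int.1 hp).irreducible.coprime_iff_not_dvd.2 hpu
      obtain ⟨a, b, hab⟩ := hcop
      have e : Pi.single i (1 : ℤ) = a • ((p : ℤ) • Pi.single i (1 : ℤ)) + b • u := by
        ext k
        by_cases hk : k = i
        · subst hk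
          simpa using hab.symm
        · have huk := congrFun hui k
          rw [Pi.single_eq_of_ne hk] at huk
          simp [Pi.single_eq_of_ne hk, huk]
      rw [e]
      exact S.add_mem (S.zsmul_mem (hpS _) _) (S.zsmul_mem huS _)
    have htop : S.toAddSubgroup = ⊤ := by
      rw [eq_top_iff]
      intro x _
      have : x = ∑ i, (x i) • Pi.single i (1 : ℤ) := by
        ext k
        simp [Finset.sum_apply, Pi.single_apply]
      rw [this]
      exact S.sum_mem fun i _ => S.zsmul_mem (hsingle i) _
    rw [htop, AddSubgroup.index_top] at hS
    exact hp.one_lt.ne hS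
  have heq : ∀ i j : Fin d, i ≠ j → (∀ x ∈ S, (p : ℤ) ∣ x i - x j) →
      S = congruenceOrder d p i j := by
    intro i j hij hle
    have h1 : S.toAddSubgroup ≤ (congruenceOrder d p i j).toAddSubgroup :=
      fun x hx => mem_congruenceOrder.2 (hle x hx)
    have h2 := AddSubgroup.relIndex_mul_index h1
    rw [hS, index_congruenceOrder hij] at h2
    have h3 : S.toAddSubgroup.relIndex (congruenceOrder d p i j).toAddSubgroup = 1 :=
      Nat.eq_of_mul_eq_mul_right hp.pos (by rw [h2, one_mul])
    exact SetLike.ext fun x => ⟨fun hx => h1 hx, fun hx => AddSubgroup.relIndex_eq_one.1 h3 hx⟩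
  rcases lt_or_gt_of_ne hij with h | h
  · exact ⟨i, j, h, heq i j hij hle⟩
  · exact ⟨j, i, h, heq j i hij.symm fun x hx => by
      rw [← neg_sub]; exact (hle x hx).neg_right⟩

theorem congruenceOrder_injective {d p : ℕ} (hp : p.Prime) {i j k l : Fin d} (hij : i < j)
    (hkl : k < l) (h : congruenceOrder d p i j = congruenceOrder d p k l) : i = k ∧ j = l := by
  have hp1 : ¬ (p : ℤ) ∣ 1 := fun h => hp.one_lt.ne' (by
    have := Int.natCast_dvd_natCast.1 (by simpa using h : (p : ℤ) ∣ ((1 : ℕ) : ℤ))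
    exact Nat.eq_one_of_dvd_one this)
  have key : ∀ m : Fin d, (m = i ∨ m = j) ↔ (m = k ∨ m = l) := by
    intro m
    have hm : ∀ a b : Fin d, a < b →
        (Pi.single m (1 : ℤ) ∈ congruenceOrder d p a b ↔ ¬ (m = a ∨ m = b)) := by
      intro a b hab
      rw [mem_congruenceOrder, Pi.single_apply, Pi.single_apply]
      by_cases ha : a = m
      · subst ha
        simp [hab.ne', hp1]
      · by_cases hb : b = m
        · subst hb
          simp [ha, hp1]
        · simp [ha, hb, Ne.symm ha, Ne.symm hb]
    rw [← not_iff_not, ← hm i j hij, ← hm k l hkl, h]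
  have h1 := (key i).1 (Or.inl rfl)
  have h2 := (key j).1 (Or.inr rfl)
  have h3 := (key k).2 (Or.inl rfl)
  omega

theorem subringCount_prime {p : ℕ} (hp : p.Prime) : subringCount (Fin 4 → ℤ) p = 6 := by
  let f : {q : Fin 4 × Fin 4 // q.1 < q.2} →
      {S : Subring (Fin 4 → ℤ) // S.toAddSubgroup.index = p} :=
    fun q => ⟨congruenceOrder 4 p q.1.1 q.1.2, index_congruenceOrder q.2.ne⟩
  have hf : Function.Bijective f := by
    constructor
    · rintro ⟨⟨i, j⟩, hij⟩ ⟨⟨k, l⟩, hkl⟩ h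
      have := congruenceOrder_injective hp hij hkl (Subtype.ext_iff.1 h)
      exact Subtype.ext (Prod.ext this.1 this.2)
    · rintro ⟨S, hS⟩
      obtain ⟨i, j, hij, rfl⟩ := exists_eq_congruenceOrder hp hS
      exact ⟨⟨(i, j), hij⟩, rfl⟩
  unfold subringCount
  rw [← Nat.card_congr (Equiv.ofBijective f hf), Nat.card_eq_fintype_card]
  decide

end PrimeIndex

section QuadraticCongruences

theorem pow_dvd_or_pow_dvd_of_pow_dvd_mul {p : ℤ} (hp : Prime p) {l m n : ℕ} {y z : ℤ}
    (h : p ^ l ∣ y * z) (hmn : m + n ≤ l + 1) : p ^ m ∣ y ∨ p ^ n ∣ z := by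
  induction m generalizing l y with
  | zero => simp
  | succ m ih =>
    by_cases hy : p ∣ y
    · obtain ⟨y', rfl⟩ := hy
      cases l with
      | zero =>
        obtain rfl : n = 0 := by omega
        simp
      | succ l =>
        rw [pow_succ', mul_assoc] at h
        rcases ih ((mul_dvd_mul_iff_left hp.ne_zero).1 h) (by omega) with h' | h'
        · left; rw [pow_succ']; exact mul_dvd_mul_left p h'
        · exact Or.inr h'
    · right
      have := hp.pow_dvd_of_dvd_mul_left l hy h
      exact (pow_dvd_pow p (by omega)).trans this

theorem card_range_filter_le_of_dvd_sub {q s : ℕ} (hs : s ∣ q) (hq : 0 < q) (X : Finset ℕ)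
    (hX : X ⊆ Finset.range q) (r t : ℤ)
    (h : ∀ x ∈ X, (s : ℤ) ∣ x - r ∨ (s : ℤ) ∣ x - t) : X.card ≤ 2 * (q / s) := by
  have hs0 : 0 < s := Nat.pos_of_dvd_of_pos hs hq
  have key : ∀ (r : ℤ) (Y : Finset ℕ), Y ⊆ Finset.range q → (∀ x ∈ Y, (s : ℤ) ∣ x - r) →
      Y.card ≤ q / s := by
    intro r Y hY hr
    rw [← Finset.card_range (q / s)]
    refine Finset.card_le_card_of_injOn (fun x => x / s) (fun x hx => ?_) fun x hx y hy hxy => ?_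
    · exact Finset.mem_coe.2 (Finset.mem_range.2
        (Nat.div_lt_div_of_lt_of_dvd hs (Finset.mem_range.1 (hY hx))))
    · have h1 : (s : ℤ) ∣ (x : ℤ) - y := by
        have := dvd_sub (hr x hx) (hr y hy)
        rwa [sub_sub_sub_cancel_right] at this
      have h2 : x % s = y % s := by
        have : (x : ℤ) % s = (y : ℤ) % s := 
          Int.emod_eq_emod_iff_emod_sub_eq_zero.2 (Int.emod_eq_zero_of_dvd h1)
        exact_mod_cast this
      have h3 : x / s = y / s := hxy
      rw [← Nat.div_add_mod x s, ← Nat.div_add_mod y s, h2, h3]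
  classical
  have hsub : X ⊆ X.filter (fun x => (s : ℤ) ∣ x - r) ∪ X.filter (fun x => (s : ℤ) ∣ x - t) := by
    intro x hx
    rw [← Finset.filter_or, Finset.mem_filter]
    exact ⟨hx, h x hx⟩
  calc X.card ≤ _ := Finset.card_le_card hsub
    _ ≤ _ := Finset.card_union_le _ _
    _ ≤ q / s + q / s := add_le_add
        (key r _ ((Finset.filter_subset _ _).trans hX) fun x hx => (Finset.mem_filter.1 hx).2)
        (key t _ ((Finset.filter_subset _ _).trans hX) fun x hx => (Finset.mem_filter.1 hx).2)
    _ = _ := by ring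

/-- The solutions in `[0, p ^ l)` of `x (x - A) ≡ K` modulo `p ^ l`. -/
def quadraticSolutions (p l : ℕ) (A K : ℤ) : Finset ℕ :=
  (Finset.range (p ^ l)).filter fun x => ((p ^ l : ℕ) : ℤ) ∣ x * (x - A) - K

theorem card_quadraticSolutions_le {p : ℕ} (hp : p.Prime) (l : ℕ) (A K : ℤ) :
    (quadraticSolutions p l A K).card ≤ 2 * p ^ (l / 2) := by
  have hp' := Nat.prime_iff_prime_int.1 hp
  rcases (quadraticSolutions p l A K).eq_empty_or_nonempty with h | ⟨r, hr⟩
  · simp [h]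
  have hr' := (Finset.mem_filter.1 hr).2
  have hdiv : p ^ l / p ^ (l - l / 2) = p ^ (l / 2) := by
    rw [Nat.pow_div (by omega) hp.pos]
    congr 1
    omega
  rw [← hdiv]
  refine card_range_filter_le_of_dvd_sub (pow_dvd_pow p (by omega)) (pow_pos hp.pos l) _
    (Finset.filter_subset _ _) r (A - r) fun x hx => ?_
  have hx' := (Finset.mem_filter.1 hx).2
  have h : (p : ℤ) ^ l ∣ ((x : ℤ) - r) * (x - (A - r)) := by
    have := dvd_sub hx' hr'
    push_cast at this
    rw [show ((x : ℤ) - r) * (x - (A - r)) = x * (x - A) - K - (r * (r - A) - K) by ring]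
    exact this
  push_cast
  exact pow_dvd_or_pow_dvd_of_pow_dvd_mul hp' h (by omega)

theorem card_quadraticSolutions_le' {p : ℕ} (hp : p.Prime) (l j : ℕ) :
    (quadraticSolutions p l (p ^ j : ℕ) 0).card ≤ 2 * p ^ j := by
  have hp' := Nat.prime_iff_prime_int.1 hp
  rcases le_or_gt l j with hlj | hlj
  · calc _ ≤ (Finset.range (p ^ l)).card := Finset.card_le_card (Finset.filter_subset _ _)
      _ = p ^ l := Finset.card_range _
      _ ≤ p ^ j := Nat.pow_le_pow_right hp.pos hlj
      _ ≤ _ := by omega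
  have hdiv : p ^ l / p ^ (l - j) = p ^ j := by
    rw [Nat.pow_div (by omega) hp.pos]
    congr 1
    omega
  refine le_of_le_of_eq (b := 2 * (p ^ l / p ^ (l - j))) ?_ (by rw [hdiv])
  refine card_range_filter_le_of_dvd_sub (pow_dvd_pow p (by omega)) (pow_pos hp.pos l) _
    (Finset.filter_subset _ _) 0 (p ^ j : ℕ) fun x hx => ?_
  have hx' := (Finset.mem_filter.1 hx).2
  rw [sub_zero] at hx'
  rw [sub_zero]
  push_cast at hx' ⊢
  by_cases h1 : (p : ℤ) ^ (j + 1) ∣ x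
  · left
    rw [mul_comm] at hx'
    refine (pow_dvd_or_pow_dvd_of_pow_dvd_mul hp' hx' (m := j + 1) (n := l - j)
      (by omega)).resolve_left fun h2 => ?_
    have h3 : (p : ℤ) ^ (j + 1) ∣ (p : ℤ) ^ j := by
      have := dvd_sub h1 h2
      rwa [sub_sub_cancel] at this
    have := (pow_dvd_pow_iff hp'.ne_zero hp'.not_isUnit).1 h3
    omega
  · exact Or.inr ((pow_dvd_or_pow_dvd_of_pow_dvd_mul hp' hx' (m := j + 1) (n := l - j)
      (by omega)).resolve_left h1)

theorem card_quadraticSolutions_le_min {p : ℕ} (hp : p.Prime) (l j : ℕ) :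
    (quadraticSolutions p l (p ^ j : ℕ) 0).card ≤ 2 * p ^ min j (l / 2) := by
  rcases min_choice j (l / 2) with h | h <;> rw [h]
  · exact card_quadraticSolutions_le' hp l j
  · exact card_quadraticSolutions_le hp l _ _

end QuadraticCongruences

section HermiteNormalForm

theorem AddSubgroup.exists_mem_iff_natCast_dvd (I : AddSubgroup ℤ) {n : ℤ} (hn : n ≠ 0)
    (hI : n ∈ I) : ∃ a : ℕ, 0 < a ∧ ∀ t, t ∈ I ↔ (a : ℤ) ∣ t := by
  obtain ⟨a, ha⟩ := Int.subgroup_cyclic I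
  have hmem : ∀ t, t ∈ I ↔ a ∣ t := fun t => by
    rw [ha, ← AddSubgroup.zmultiples_eq_closure, Int.mem_zmultiples_iff]
  refine ⟨a.natAbs, ?_, fun t => by rw [hmem, Int.natAbs_dvd]⟩
  rw [Int.natAbs_pos]
  rintro rfl
  exact hn (zero_dvd_iff.1 ((hmem n).1 hI))

/-- `S` is spanned by `1` and the rows `(a, b, c, 0)`, `(0, d, e, 0)`, `(0, 0, g, 0)`. -/
def HasHermiteBasis (S : Subring (Fin 4 → ℤ)) (a d g b e c : ℕ) : Prop :=
  ∀ x, x ∈ S ↔ ∃ t u w : ℤ, x 0 - x 3 = a * t ∧ x 1 - x 3 = b * t + d * u ∧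
    x 2 - x 3 = c * t + e * u + g * w

theorem exists_hasHermiteBasis {S : Subring (Fin 4 → ℤ)} (hS : S.toAddSubgroup.index ≠ 0) :
    ∃ a d g b e c : ℕ, 0 < a ∧ 0 < d ∧ 0 < g ∧ b < d ∧ e < g ∧ c < g ∧
      HasHermiteBasis S a d g b e c := by
  set n := S.toAddSubgroup.index with hn
  let ev : Fin 4 → ((Fin 4 → ℤ) →+ ℤ) := fun i => Pi.evalAddMonoidHom (fun _ => ℤ) i
  have hnS : ∀ i : Fin 4, Pi.single i (n : ℤ) ∈ S := fun i => by
    have := S.toAddSubgroup.nsmul_index_mem (Pi.single i (1 : ℤ))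
    rw [← hn, ← Pi.single_smul, nsmul_eq_mul, mul_one] at this
    exact this
  have hn' : (n : ℤ) ≠ 0 := by exact_mod_cast hS
  let H0 := S.toAddSubgroup ⊓ (ev 3).ker
  let H1 := H0 ⊓ (ev 0).ker
  let H2 := H1 ⊓ (ev 1).ker
  have mem0 : ∀ x, x ∈ H0 ↔ x ∈ S ∧ x 3 = 0 := fun x => Iff.rfl
  have mem1 : ∀ x, x ∈ H1 ↔ x ∈ H0 ∧ x 0 = 0 := fun x => Iff.rfl
  have mem2 : ∀ x, x ∈ H2 ↔ x ∈ H1 ∧ x 1 = 0 := fun x => Iff.rfl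
  obtain ⟨a, ha, hamem⟩ := (H0.map (ev 0)).exists_mem_iff_natCast_dvd hn'
    ⟨_, (mem0 _).2 ⟨hnS 0, by simp⟩, by simp [ev]⟩
  obtain ⟨d, hd, hdmem⟩ := (H1.map (ev 1)).exists_mem_iff_natCast_dvd hn'
    ⟨_, (mem1 _).2 ⟨(mem0 _).2 ⟨hnS 1, by simp⟩, by simp⟩, by simp [ev]⟩
  obtain ⟨g, hg, hgmem⟩ := (H2.map (ev 2)).exists_mem_iff_natCast_dvd hn'
    ⟨_, (mem2 _).2 ⟨(mem1 _).2 ⟨(mem0 _).2 ⟨hnS 2, by simp⟩, by simp⟩, by simp⟩, by simp [ev]⟩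
  obtain ⟨v1, hv1, hv1a⟩ := (hamem a).2 dvd_rfl
  obtain ⟨v2, hv2, hv2d⟩ := (hdmem d).2 dvd_rfl
  obtain ⟨v3, hv3, hv3g⟩ := (hgmem g).2 dvd_rfl
  replace hv1a : v1 0 = a := hv1a
  replace hv2d : v2 1 = d := hv2d
  replace hv3g : v3 2 = g := hv3g
  have hdz : (0 : ℤ) < d := by exact_mod_cast hd
  have hgz : (0 : ℤ) < g := by exact_mod_cast hg
  have hv31 := ((mem2 _).1 hv3).2
  have hv30 := ((mem1 _).1 ((mem2 _).1 hv3).1).2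
  have hv20 := ((mem1 _).1 hv2).2
  have h21 : H2 ≤ H1 := inf_le_left
  have h10 : H1 ≤ H0 := inf_le_left
  let r2 := v2 - (v2 2 / g) • v3
  have hr2 : r2 ∈ H1 := H1.sub_mem hv2 (H1.zsmul_mem (h21 hv3) _)
  have hr2e : r2 2 = v2 2 % g := by
    simp only [r2, Pi.sub_apply, Pi.smul_apply, smul_eq_mul, hv3g]
    rw [Int.emod_def]; ring
  have hr2d : r2 1 = d := by simp [r2, hv31, hv2d]
  have hr20 : r2 0 = 0 := ((mem1 _).1 hr2).2
  let q1 := v1 - (v1 1 / d) • r2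
  have hq1 : q1 ∈ H0 := H0.sub_mem hv1 (H0.zsmul_mem (h10 hr2) _)
  have hq1b : q1 1 = v1 1 % d := by
    simp only [q1, Pi.sub_apply, Pi.smul_apply, smul_eq_mul, hr2d]
    rw [Int.emod_def]; ring
  let r1 := q1 - (q1 2 / g) • v3
  have hr1 : r1 ∈ H0 := H0.sub_mem hq1 (H0.zsmul_mem (h10 (h21 hv3)) _)
  have hr1c : r1 2 = q1 2 % g := by
    simp only [r1, Pi.sub_apply, Pi.smul_apply, smul_eq_mul, hv3g]
    rw [Int.emod_def]; ring
  have hr1b : r1 1 = v1 1 % d := by simp [r1, hv31, hq1b]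
  have hr1a : r1 0 = a := by simp [r1, q1, hv30, hr20, hv1a]
  obtain ⟨b, hb⟩ := Int.eq_ofNat_of_zero_le (Int.emod_nonneg (v1 1) hdz.ne')
  obtain ⟨e, he⟩ := Int.eq_ofNat_of_zero_le (Int.emod_nonneg (v2 2) hgz.ne')
  obtain ⟨c, hc⟩ := Int.eq_ofNat_of_zero_le (Int.emod_nonneg (q1 2) hgz.ne')
  have hbd := Int.emod_lt_of_pos (v1 1) hdz
  have heg := Int.emod_lt_of_pos (v2 2) hgz
  have hcg := Int.emod_lt_of_pos (q1 2) hgz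
  rw [hb] at hbd hr1b
  rw [he] at heg hr2e
  rw [hc] at hcg hr1c
  refine ⟨a, d, g, b, e, c, ha, hd, hg, by exact_mod_cast hbd, by exact_mod_cast heg,
    by exact_mod_cast hcg, fun x => ⟨fun hx => ?_, ?_⟩⟩
  · have hy : x - x 3 • (1 : Fin 4 → ℤ) ∈ H0 :=
      (mem0 _).2 ⟨S.sub_mem hx (S.zsmul_mem S.one_mem _), by simp⟩
    obtain ⟨t, ht⟩ := (hamem _).1 ⟨_, hy, rfl⟩
    have ht' : x 0 - x 3 = a * t := by simpa [ev] using ht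
    have hy1 : x - x 3 • (1 : Fin 4 → ℤ) - t • r1 ∈ H1 :=
      (mem1 _).2 ⟨H0.sub_mem hy (H0.zsmul_mem hr1 _), by simp [hr1a, ht', mul_comm]⟩
    obtain ⟨u, hu⟩ := (hdmem _).1 ⟨_, hy1, rfl⟩
    have hu' : x 1 - x 3 - t * b = d * u := by simpa [ev, hr1b] using hu
    have hy2 : x - x 3 • (1 : Fin 4 → ℤ) - t • r1 - u • r2 ∈ H2 :=
      (mem2 _).2 ⟨H1.sub_mem hy1 (H1.zsmul_mem hr2 _), by
        simp [hr1b, hr2d]; linarith⟩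
    obtain ⟨w, hw⟩ := (hgmem _).1 ⟨_, hy2, rfl⟩
    have hw' : x 2 - x 3 - t * c - u * e = g * w := by simpa [ev, hr1c, hr2e] using hw
    exact ⟨t, u, w, ht', by linarith, by linarith⟩
  · rintro ⟨t, u, w, h0, h1, h2⟩
    have hr13 : r1 3 = 0 := ((mem0 _).1 hr1).2
    have hr23 : r2 3 = 0 := ((mem0 _).1 (h10 hr2)).2
    have hv33 : v3 3 = 0 := ((mem0 _).1 (h10 (h21 hv3))).2
    have hx : x = x 3 • (1 : Fin 4 → ℤ) + t • r1 + u • r2 + w • v3 := by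
      ext i
      fin_cases i
      · simp [hr1a, hr20, hv30]; linarith
      · simp [hr1b, hr2d, hv31]; linarith
      · simp [hr1c, hr2e, hv3g]; linarith
      · simp [hr13, hr23, hv33]
    rw [hx]
    exact S.add_mem (S.add_mem (S.add_mem (S.zsmul_mem S.one_mem _)
      (S.zsmul_mem ((mem0 _).1 hr1).1 _)) (S.zsmul_mem ((mem0 _).1 (h10 hr2)).1 _))
      (S.zsmul_mem ((mem0 _).1 (h10 (h21 hv3))).1 _)

namespace HasHermiteBasis

variable {S : Subring (Fin 4 → ℤ)} {a d g b e c : ℕ}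

theorem subring_unique {T : Subring (Fin 4 → ℤ)} (hS : HasHermiteBasis S a d g b e c)
    (hT : HasHermiteBasis T a d g b e c) : S = T :=
  SetLike.ext fun x => (hS x).trans (hT x).symm

theorem index_eq (hS : HasHermiteBasis S a d g b e c) (ha : 0 < a) (hd : 0 < d) (hg : 0 < g) :
    S.toAddSubgroup.index = a * d * g := by
  have haz : (0 : ℤ) < a := by exact_mod_cast ha
  have hdz : (0 : ℤ) < d := by exact_mod_cast hd
  have hgz : (0 : ℤ) < g := by exact_mod_cast hg
  let v : Fin a × Fin d × Fin g → (Fin 4 → ℤ) :=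
    fun q => ![(q.1 : ℕ), (q.2.1 : ℕ), (q.2.2 : ℕ), 0]
  let f : Fin a × Fin d × Fin g → (Fin 4 → ℤ) ⧸ S.toAddSubgroup := fun q => (v q : _)
  have small : ∀ {m : ℕ} (i j : Fin m) (t : ℤ), ((j : ℕ) : ℤ) - (i : ℕ) = m * t → i = j ∧ t = 0 := by
    intro m i j t h
    have hi := i.2
    have hj := j.2
    have ht : t = 0 := by
      have := Int.eq_zero_of_abs_lt_dvd (Dvd.intro t h.symm) (by rw [abs_lt]; omega)
      rw [this] at h
      rcases mul_eq_zero.1 h.symm with h | h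
      · omega
      · exact h
    refine ⟨Fin.ext ?_, ht⟩
    rw [ht, mul_zero] at h
    omega
  have hf : Function.Bijective f := by
    constructor
    · rintro ⟨i, j, l⟩ ⟨i', j', l'⟩ h
      have h' : -v (i, j, l) + v (i', j', l') ∈ S := QuotientAddGroup.eq.1 h
      obtain ⟨t, u, w, h0, h1, h2⟩ := (hS _).1 h'
      simp [v] at h0 h1 h2
      obtain ⟨rfl, rfl⟩ := small i i' t (by linarith)
      obtain ⟨rfl, rfl⟩ := small j j' u (by linarith)
      obtain ⟨rfl, rfl⟩ := small l l' w (by linarith)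
      rfl
    · intro y
      obtain ⟨x, rfl⟩ := QuotientAddGroup.mk_surjective y
      have lift : ∀ {m : ℕ}, (0 : ℤ) < m → ∀ z : ℤ, ∃ (i : Fin m) (t : ℤ), z = (i : ℕ) + m * t := by
        intro m hm z
        obtain ⟨i, hi⟩ := Int.eq_ofNat_of_zero_le (Int.emod_nonneg z hm.ne')
        have := Int.emod_lt_of_pos z hm
        refine ⟨⟨i, by omega⟩, z / m, ?_⟩
        change z = (i : ℤ) + _
        rw [← hi, Int.emod_add_mul_ediv]
      obtain ⟨i, t, hi⟩ := lift haz (x 0 - x 3)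
      obtain ⟨j, u, hj⟩ := lift hdz (x 1 - x 3 - b * t)
      obtain ⟨l, w, hl⟩ := lift hgz (x 2 - x 3 - c * t - e * u)
      refine ⟨(i, j, l), QuotientAddGroup.eq.2 ((hS _).2 ⟨t, u, w, ?_, ?_, ?_⟩)⟩
      · simp [v]; linarith
      · simp [v]; linarith
      · simp [v]; linarith
  calc S.toAddSubgroup.index = Nat.card ((Fin 4 → ℤ) ⧸ S.toAddSubgroup) := rfl
    _ = Nat.card (Fin a × Fin d × Fin g) := (Nat.card_congr (Equiv.ofBijective f hf)).symm
    _ = a * d * g := by simp [mul_assoc]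

theorem dvd_conditions (hS : HasHermiteBasis S a d g b e c) (ha : 0 < a) (hd : 0 < d) :
    (d : ℤ) ∣ b * (b - a) - 0 ∧ (g : ℤ) ∣ e * (e - d) - 0 ∧
      (g : ℤ) ∣ c * (c - a) - (b * (b - a) / d) * e := by
  have hdz : (d : ℤ) ≠ 0 := by exact_mod_cast hd.ne'
  have h1 : ![(a : ℤ), b, c, 0] ∈ S := (hS _).2 ⟨1, 0, 0, by simp, by simp, by simp⟩
  have h2 : ![(0 : ℤ), d, e, 0] ∈ S := (hS _).2 ⟨0, 1, 0, by simp, by simp, by simp⟩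
  obtain ⟨t, u, w, ht, hu, hw⟩ := (hS _).1 (S.mul_mem h1 h1)
  obtain ⟨t', u', w', ht', hu', hw'⟩ := (hS _).1 (S.mul_mem h2 h2)
  simp at ht hu hw ht' hu' hw'
  obtain rfl : (a : ℤ) = t := ht.resolve_right ha.ne'
  obtain rfl : t' = 0 := ht'.resolve_left ha.ne'
  obtain rfl : (d : ℤ) = u' := mul_left_cancel₀ hdz (by linarith)
  refine ⟨⟨u, by linarith⟩, ⟨w', by linarith⟩, ⟨w, ?_⟩⟩
  have : (b : ℤ) * (b - a) / d = u := by
    rw [show (b : ℤ) * (b - a) = d * u by linarith, Int.mul_ediv_cancel_left _ hdz]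
  rw [this]
  linarith

end HasHermiteBasis

end HermiteNormalForm

section PrimePowerBound

/-- Candidate Hermite bases for orders of index `p ^ k`, indexed by the exponents of the first two
diagonal entries. -/
def hermiteCodes (p k : ℕ) : Finset (Σ _ : ℕ × ℕ, Σ _ : ℕ × ℕ, ℕ) :=
  ((Finset.range (k + 1) ×ˢ Finset.range (k + 1)).filter fun q => q.1 + q.2 ≤ k).sigma fun q =>
    (quadraticSolutions p q.2 (p ^ q.1 : ℕ) 0 ×ˢ
      quadraticSolutions p (k - q.1 - q.2) (p ^ q.2 : ℕ) 0).sigma fun r =>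
      quadraticSolutions p (k - q.1 - q.2) (p ^ q.1 : ℕ)
        ((r.1 * (r.1 - (p ^ q.1 : ℕ)) / (p ^ q.2 : ℕ)) * r.2)

theorem card_hermiteCodes_le {p k : ℕ} (hp : p.Prime) (hk : 2 ≤ k) :
    (hermiteCodes p k).card ≤ 8 * (k + 1) ^ 2 * p ^ (6 * k / 7 - 1) := by
  rw [hermiteCodes, Finset.card_sigma]
  have hfiber : ∀ q ∈ (Finset.range (k + 1) ×ˢ Finset.range (k + 1)).filter
      (fun q => q.1 + q.2 ≤ k),
      ((quadraticSolutions p q.2 (p ^ q.1 : ℕ) 0 ×ˢ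
      quadraticSolutions p (k - q.1 - q.2) (p ^ q.2 : ℕ) 0).sigma fun r =>
      quadraticSolutions p (k - q.1 - q.2) (p ^ q.1 : ℕ)
        ((r.1 * (r.1 - (p ^ q.1 : ℕ)) / (p ^ q.2 : ℕ)) * r.2)).card
        ≤ 8 * p ^ (6 * k / 7 - 1) := by
    rintro ⟨i, j⟩ hq
    have hij : i + j ≤ k := (Finset.mem_filter.1 hq).2
    dsimp only
    obtain ⟨l, hl⟩ : ∃ l, l = k - i - j := ⟨_, rfl⟩
    rw [← hl, Finset.card_sigma]
    have hb := card_quadraticSolutions_le_min hp j i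
    have he := card_quadraticSolutions_le_min hp l j
    obtain ⟨m, hm, hml⟩ : ∃ m, (∀ r ∈ quadraticSolutions p j (p ^ i : ℕ) 0 ×ˢ
        quadraticSolutions p l (p ^ j : ℕ) 0, (quadraticSolutions p l (p ^ i : ℕ)
          ((r.1 * (r.1 - (p ^ i : ℕ)) / (p ^ j : ℕ)) * r.2)).card ≤ 2 * p ^ m) ∧
        min i (j / 2) + min j (l / 2) + m ≤ 6 * k / 7 - 1 := by
      rcases Nat.eq_zero_or_pos i with rfl | hi
      · refine ⟨0, fun r hr => ?_, by omega⟩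
        have hr1 := (Finset.mem_filter.1 (Finset.mem_product.1 hr).1)
        have hlt := Finset.mem_range.1 hr1.1
        have hz : (r.1 : ℤ) * (r.1 - (p ^ 0 : ℕ)) / (p ^ j : ℕ) = 0 := by
          suffices h : (r.1 : ℤ) * (r.1 - (p ^ 0 : ℕ)) = 0 by rw [h, Int.zero_ediv]
          rcases Nat.eq_zero_or_pos r.1 with h0 | h0
          · simp [h0]
          have hdvd : p ^ j ∣ r.1 * (r.1 - 1) := by
            have := hr1.2
            rw [sub_zero, pow_zero, ← Nat.cast_sub (show 1 ≤ r.1 from h0)] at this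
            exact_mod_cast this
          have hcop : Nat.Coprime r.1 (r.1 - 1) :=
            (Nat.coprime_self_sub_right (show 1 ≤ r.1 from h0)).2 (Nat.coprime_one_right _)
          have hj : j ≠ 0 := by
            rintro rfl
            rw [pow_zero] at hlt
            omega
          rcases (hcop.isPrimePow_dvd_mul (hp.isPrimePow.pow hj)).1 hdvd with h | h
          · exact absurd (Nat.le_of_dvd h0 h) (by omega)
          · have : r.1 - 1 = 0 := Nat.eq_zero_of_dvd_of_lt h (by omega)
            have : r.1 = 1 := by omega
            simp [this]
        rw [hz, zero_mul]
        exact card_quadraticSolutions_le' hp l 0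
      · exact ⟨l / 2, fun r _ => card_quadraticSolutions_le hp l _ _, by omega⟩
    calc _ ≤ ∑ _r ∈ quadraticSolutions p j (p ^ i : ℕ) 0 ×ˢ
        quadraticSolutions p l (p ^ j : ℕ) 0, 2 * p ^ m := Finset.sum_le_sum hm
      _ = (quadraticSolutions p j (p ^ i : ℕ) 0).card *
        (quadraticSolutions p l (p ^ j : ℕ) 0).card * (2 * p ^ m) := by
          rw [Finset.sum_const, Finset.card_product, smul_eq_mul]
      _ ≤ (2 * p ^ min i (j / 2)) * (2 * p ^ min j (l / 2)) * (2 * p ^ m) := by gcongr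
      _ = 8 * p ^ (min i (j / 2) + min j (l / 2) + m) := by rw [pow_add, pow_add]; ring
      _ ≤ _ := by
        gcongr
        exact hp.one_le
  calc _ ≤ ∑ _q ∈ (Finset.range (k + 1) ×ˢ Finset.range (k + 1)).filter
        (fun q => q.1 + q.2 ≤ k), 8 * p ^ (6 * k / 7 - 1) := Finset.sum_le_sum hfiber
    _ ≤ (k + 1) ^ 2 * (8 * p ^ (6 * k / 7 - 1)) := by
      rw [Finset.sum_const, smul_eq_mul]
      gcongr
      refine (Finset.card_filter_le _ _).trans ?_
      rw [Finset.card_product, Finset.card_range, sq]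
    _ = _ := by ring

theorem subringCount_prime_pow_le {p k : ℕ} (hp : p.Prime) (hk : 2 ≤ k) :
    subringCount (Fin 4 → ℤ) (p ^ k) ≤ 8 * (k + 1) ^ 2 * p ^ (6 * k / 7 - 1) := by
  refine le_trans ?_ (card_hermiteCodes_le hp hk)
  have hcode : ∀ S : {S : Subring (Fin 4 → ℤ) // S.toAddSubgroup.index = p ^ k},
      ∃ q : hermiteCodes p k, HasHermiteBasis S.1 (p ^ q.1.1.1) (p ^ q.1.1.2)
        (p ^ (k - q.1.1.1 - q.1.1.2)) q.1.2.1.1 q.1.2.1.2 q.1.2.2 := by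
    rintro ⟨S, hS⟩
    obtain ⟨a, d, g, b, e, c, ha, hd, hg, hb, he, hc, hB⟩ := exists_hasHermiteBasis
      (S := S) (by rw [hS]; exact (pow_pos hp.pos k).ne')
    have hidx := hB.index_eq ha hd hg
    rw [hS] at hidx
    obtain ⟨i, hi, rfl⟩ := (Nat.dvd_prime_pow hp).1 (hidx ▸ ⟨d * g, by ring⟩ : a ∣ p ^ k)
    obtain ⟨j, hj, rfl⟩ := (Nat.dvd_prime_pow hp).1 (hidx ▸ ⟨p ^ i * g, by ring⟩ : d ∣ p ^ k)
    obtain ⟨l, hl, rfl⟩ := (Nat.dvd_prime_pow hp).1 (hidx ▸ ⟨p ^ i * p ^ j, by ring⟩ : g ∣ p ^ k)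
    rw [← pow_add, ← pow_add] at hidx
    have hsum := Nat.pow_right_injective hp.two_le hidx
    obtain rfl : l = k - i - j := by omega
    obtain ⟨h1, h2, h3⟩ := hB.dvd_conditions ha hd
    refine ⟨⟨⟨(i, j), ⟨(b, e), c⟩⟩, ?_⟩, hB⟩
    simp only [hermiteCodes, Finset.mem_sigma, Finset.mem_filter, Finset.mem_product,
      Finset.mem_range, quadraticSolutions]
    exact ⟨⟨⟨by omega, by omega⟩, by omega⟩, ⟨⟨hb, h1⟩, ⟨he, h2⟩⟩, hc, h3⟩
  choose f hf using hcode
  have hinj : Function.Injective f := fun S T h => by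
    have hT := hf T
    rw [← h] at hT
    exact Subtype.ext ((hf S).subring_unique hT)
  have := Nat.card_le_card_of_injective f hinj
  rwa [Nat.card_eq_fintype_card (α := hermiteCodes p k), Fintype.card_coe] at this

theorem finite_subrings_of_index {d n : ℕ} (hn : n ≠ 0) :
    Finite {S : Subring (Fin d → ℤ) // S.toAddSubgroup.index = n} := by
  have : NeZero n := ⟨hn⟩
  let r : (Fin d → ℤ) → (Fin d → ZMod n) := fun x i => (x i : ZMod n)
  refine Finite.of_injective (fun S => r '' (S.1 : Set (Fin d → ℤ))) fun S T h => ?_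
  have key : ∀ S T : {S : Subring (Fin d → ℤ) // S.toAddSubgroup.index = n},
      r '' (S.1 : Set (Fin d → ℤ)) = r '' (T.1 : Set (Fin d → ℤ)) → S.1 ≤ T.1 := by
    intro S T h x hx
    obtain ⟨y, hy, hyx⟩ : r x ∈ r '' (T.1 : Set (Fin d → ℤ)) := h ▸ ⟨x, hx, rfl⟩
    have hdvd : ∀ i, (n : ℤ) ∣ x i - y i := fun i => by
      rw [← ZMod.intCast_zmod_eq_zero_iff_dvd, Int.cast_sub, sub_eq_zero]
      exact (congrFun hyx i).symm
    choose z hz using hdvd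
    have hx' : x = y + (n : Fin d → ℤ) * z := by
      ext i
      have := hz i
      simp only [Pi.add_apply, Pi.mul_apply, Pi.natCast_apply]
      linarith
    rw [hx']
    exact T.1.add_mem hy (nsmul_mem_of_index T.2 z)
  exact Subtype.ext (le_antisymm (key S T h) (key T S h.symm))

theorem numOrders_eq_sum {d : ℕ} {B : ℝ} (hB : 0 ≤ B) :
    Nat.card {O : Subring (Fin d → ℤ) //
      O.toAddSubgroup.index ≠ 0 ∧ (O.toAddSubgroup.index : ℝ) ≤ B} =
      ∑ n ∈ Finset.Ioc 0 ⌊B⌋₊, subringCount (Fin d → ℤ) n := by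
  have e : {O : Subring (Fin d → ℤ) //
      O.toAddSubgroup.index ≠ 0 ∧ (O.toAddSubgroup.index : ℝ) ≤ B} ≃
      Σ n : Finset.Ioc 0 ⌊B⌋₊, {S : Subring (Fin d → ℤ) // S.toAddSubgroup.index = n.1} :=
    { toFun := fun O => ⟨⟨O.1.toAddSubgroup.index, Finset.mem_Ioc.2
        ⟨Nat.pos_of_ne_zero O.2.1, Nat.le_floor O.2.2⟩⟩, ⟨O.1, rfl⟩⟩
      invFun := fun q => ⟨q.2.1, by
        have h := Finset.mem_Ioc.1 q.1.2
        rw [q.2.2]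
        exact ⟨h.1.ne', (Nat.le_floor_iff hB).1 h.2⟩⟩
      left_inv := fun O => rfl
      right_inv := by
        rintro ⟨⟨n, hn⟩, ⟨S, hS⟩⟩
        dsimp only at hS
        subst hS
        rfl }
  have : ∀ n : Finset.Ioc 0 ⌊B⌋₊,
      Finite {S : Subring (Fin d → ℤ) // S.toAddSubgroup.index = n.1} :=
    fun n => finite_subrings_of_index (Finset.mem_Ioc.1 n.2).1.ne'
  rw [Nat.card_congr e, Nat.card_sigma]
  exact Finset.sum_coe_sort _ (fun n => subringCount (Fin d → ℤ) n)

end PrimePowerBound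

open Polynomial in
/-- The summatory function of `a` is `x * P (log x) + O (x ^ θ)` on `[1, ∞)`. -/
def HasMainTerm (a : ArithmeticFunction ℝ) (P : ℝ[X]) (θ : ℝ) : Prop :=
  ∃ C : ℝ, ∀ x : ℝ, 1 ≤ x →
    |∑ n ∈ Finset.Ioc 0 ⌊x⌋₊, a n - x * P.eval (Real.log x)| ≤ C * x ^ θ

/-- A polynomial in `log t` is dominated by every positive power of `t`. -/
theorem exists_abs_eval_log_le (p : Polynomial ℝ) {δ : ℝ} (hδ : 0 < δ) :
    ∃ C : ℝ, 0 ≤ C ∧ ∀ t : ℝ, 1 ≤ t → |p.eval (Real.log t)| ≤ C * t ^ δ := by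
  induction p using Polynomial.induction_on' with
  | add p q hp hq =>
    obtain ⟨C, hC, h⟩ := hp
    obtain ⟨D, hD, h'⟩ := hq
    refine ⟨C + D, by positivity, fun t ht => ?_⟩
    rw [Polynomial.eval_add, add_mul]
    exact (abs_add_le _ _).trans (add_le_add (h t ht) (h' t ht))
  | monomial n a =>
    rcases Nat.eq_zero_or_pos n with rfl | hn
    · refine ⟨|a|, abs_nonneg _, fun t ht => ?_⟩
      simpa using le_mul_of_one_le_right (abs_nonneg a) (Real.one_le_rpow ht hδ.le)
    · have hn' : (0 : ℝ) < n := by exact_mod_cast hn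
      refine ⟨|a| * (1 / (δ / n)) ^ n, by positivity, fun t ht => ?_⟩
      have h1 : Real.log t ≤ t ^ (δ / n) / (δ / n) :=
        Real.log_le_rpow_div (by linarith) (by positivity)
      have h0 := Real.log_nonneg ht
      rw [Polynomial.eval_monomial, abs_mul, abs_pow, abs_of_nonneg h0, mul_assoc]
      gcongr
      calc Real.log t ^ n ≤ (t ^ (δ / n) / (δ / n)) ^ n := by gcongr
        _ = (1 / (δ / n)) ^ n * (t ^ (δ / n)) ^ n := by rw [← mul_pow]; congr 1; ring
        _ = (1 / (δ / n)) ^ n * t ^ δ := by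
          rw [← Real.rpow_natCast (t ^ (δ / n)), ← Real.rpow_mul (by linarith)]
          congr 2; field_simp

theorem hasDerivAt_eval_log (p : Polynomial ℝ) {t : ℝ} (ht : 0 < t) :
    HasDerivAt (fun s => p.eval (Real.log s)) (p.derivative.eval (Real.log t) / t) t := by
  rw [div_eq_mul_inv]
  exact (p.hasDerivAt (Real.log t)).comp t (Real.hasDerivAt_log ht.ne')

theorem hasDerivAt_eval_log_div (p : Polynomial ℝ) {t : ℝ} (ht : 0 < t) :
    HasDerivAt (fun s => p.eval (Real.log s) / s)
      ((p.derivative - p).eval (Real.log t) / t ^ 2) t := by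
  convert! (hasDerivAt_eval_log p ht).div (hasDerivAt_id t) ht.ne' using 1
  simp; field_simp

theorem continuousOn_eval_log (p : Polynomial ℝ) :
    ContinuousOn (fun s => p.eval (Real.log s)) (Set.Ioi 0) := fun _ ht =>
  (hasDerivAt_eval_log p ht).continuousAt.continuousWithinAt

theorem ArithmeticFunction.sum_Icc_zero_eq (a : ArithmeticFunction ℝ) (f : ℕ → ℝ) (N : ℕ) :
    ∑ k ∈ Finset.Icc 0 N, f k * a k = ∑ k ∈ Finset.Ioc 0 N, f k * a k := by
  rw [Finset.Icc_eq_cons_Ioc (Nat.zero_le _), Finset.sum_cons, a.map_zero, mul_zero, zero_add]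

open MeasureTheory in
/-- An integrable function bounded by `C * t ^ (σ - 2)` has integral over `(1, w]` converging at
rate `w ^ (σ - 1)`. -/
theorem exists_integral_Ioc_approx {e : ℝ → ℝ} {C σ : ℝ} (hσ : σ < 1)
    (he : AEStronglyMeasurable e (volume.restrict (Set.Ioi 1)))
    (hb : ∀ t, 1 ≤ t → |e t| ≤ C * t ^ (σ - 2)) :
    ∃ I : ℝ, ∀ w, 1 ≤ w → |(∫ t in Set.Ioc 1 w, e t) - I| ≤ C / (1 - σ) * w ^ (σ - 1) := by
  have hbase : ∀ w : ℝ, 1 ≤ w → IntegrableOn (fun t : ℝ => C * t ^ (σ - 2)) (Set.Ioi w) :=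
    fun w hw => (integrableOn_Ioi_rpow_of_lt (by linarith) (by linarith)).const_mul C
  have hei : IntegrableOn e (Set.Ioi 1) := by
    refine Integrable.mono' (hbase 1 le_rfl) he ?_
    filter_upwards [ae_restrict_mem measurableSet_Ioi] with t ht
    exact hb t (le_of_lt ht)
  refine ⟨∫ t in Set.Ioi 1, e t, fun w hw => ?_⟩
  have hsplit : ∫ t in Set.Ioi 1, e t = (∫ t in Set.Ioc 1 w, e t) + ∫ t in Set.Ioi w, e t := by
    rw [← Set.Ioc_union_Ioi_eq_Ioi hw]
    exact setIntegral_union (Set.Ioc_disjoint_Ioi le_rfl) measurableSet_Ioi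
      (hei.mono_set Set.Ioc_subset_Ioi_self) (hei.mono_set (Set.Ioi_subset_Ioi hw))
  rw [hsplit, sub_add_cancel_left, abs_neg]
  calc |∫ t in Set.Ioi w, e t| ≤ ∫ t in Set.Ioi w, C * t ^ (σ - 2) := by
        rw [← Real.norm_eq_abs]
        refine norm_integral_le_of_norm_le (hbase w hw) ?_
        filter_upwards [ae_restrict_mem measurableSet_Ioi] with t ht
        exact hb t (hw.trans (le_of_lt ht))
    _ = C / (1 - σ) * w ^ (σ - 1) := by
        rw [integral_const_mul, integral_Ioi_rpow_of_lt (by linarith) (by linarith),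
          show σ - 2 + 1 = σ - 1 by ring, show 1 - σ = -(σ - 1) by ring, div_neg, neg_div]
        ring

open MeasureTheory Polynomial in
/-- Partial summation against a polynomial in `log m` divided by `m`. -/
theorem HasMainTerm.exists_sum_eval_log_div {a : ArithmeticFunction ℝ} {P : ℝ[X]} {θ : ℝ}
    (h : HasMainTerm a P θ) {σ : ℝ} (hθ : θ < σ) (hσ : σ < 1) {p q : ℝ[X]}
    (hq : derivative q = (P + derivative P) * p) :
    ∃ κ C : ℝ, ∀ w : ℝ, 1 ≤ w →
      |∑ m ∈ Finset.Ioc 0 ⌊w⌋₊, p.eval (Real.log m) / m * a m - q.eval (Real.log w) - κ|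
        ≤ C * w ^ (σ - 1) := by
  obtain ⟨C, hC⟩ := h
  have hC0 : 0 ≤ C := by simpa using (abs_nonneg _).trans (hC 1 le_rfl)
  set F : ℝ → ℝ := fun x => ∑ n ∈ Finset.Ioc 0 ⌊x⌋₊, a n with hF
  set E : ℝ → ℝ := fun x => F x - x * P.eval (Real.log x) with hE
  set f : ℝ → ℝ := fun s => p.eval (Real.log s) / s with hf
  set S := p * P - q with hS
  have hderiv : ∀ t : ℝ, 1 ≤ t → deriv f t = (derivative p - p).eval (Real.log t) / t ^ 2 :=
    fun t ht => (hasDerivAt_eval_log_div p (by linarith)).deriv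
  obtain ⟨D, hD0, hD⟩ := exists_abs_eval_log_le (derivative p - p) (sub_pos.2 hθ)
  obtain ⟨D', hD0', hD'⟩ := exists_abs_eval_log_le p (sub_pos.2 hθ)
  have hpow : ∀ t : ℝ, 1 ≤ t → t ^ (σ - θ) * t ^ θ = t ^ σ := fun t ht => by
    rw [← Real.rpow_add (by linarith)]; congr 1; ring
  have hfE : ∀ t : ℝ, 1 ≤ t → |(derivative p - p).eval (Real.log t) / t ^ 2 * E t|
      ≤ D * C * t ^ (σ - 2) := fun t ht => by
    have ht0 : 0 < t := by linarith
    rw [abs_mul, abs_div, abs_of_pos (pow_pos ht0 2)]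
    calc _ ≤ D * t ^ (σ - θ) / t ^ 2 * (C * t ^ θ) := by
          gcongr
          exacts [hD t ht, hC t ht]
      _ = D * C * ((t ^ (σ - θ) * t ^ θ) / t ^ 2) := by ring
      _ = _ := by
          rw [hpow t ht, Real.rpow_sub ht0]; norm_cast
  have hFm : Measurable F := by
    have : Measurable (fun N : ℕ => ∑ n ∈ Finset.Ioc 0 N, a n) := measurable_from_top
    exact this.comp Nat.measurable_floor
  have hpm : ∀ r : ℝ[X], Measurable (fun t : ℝ => r.eval (Real.log t)) := fun r =>
    r.continuous.measurable.comp Real.measurable_log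
  have hEm : Measurable E := hFm.sub (measurable_id.mul (hpm P))
  obtain ⟨I, hI⟩ := exists_integral_Ioc_approx (e := fun t =>
    (derivative p - p).eval (Real.log t) / t ^ 2 * E t) hσ
    (((hpm _).div (measurable_id.pow_const 2)).mul hEm).aestronglyMeasurable hfE
  refine ⟨S.eval 0 - I, D' * C + D * C / (1 - σ), fun w hw => ?_⟩
  have hw0 : 0 < w := by linarith
  have hcont : ∀ r : ℝ[X], ContinuousOn (fun s : ℝ => r.eval (Real.log s)) (Set.Icc 1 w) :=
    fun r => (continuousOn_eval_log r).mono fun s hs => lt_of_lt_of_le one_pos hs.1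
  have hne : ∀ s ∈ Set.Icc 1 w, s ≠ 0 := fun s hs => (lt_of_lt_of_le one_pos hs.1).ne'
  have hdc : ContinuousOn (fun s : ℝ => (derivative p - p).eval (Real.log s) / s ^ 2)
      (Set.Icc 1 w) :=
    (hcont _).div (continuousOn_pow 2) fun s hs => pow_ne_zero 2 (hne s hs)
  have hdi : IntegrableOn (deriv f) (Set.Icc 1 w) :=
    (hdc.integrableOn_Icc).congr_fun (fun s hs => (hderiv s hs.1).symm) measurableSet_Icc
  have habel := sum_mul_eq_sub_integral_mul₀ (f := f) a a.map_zero w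
    (fun t ht => (hasDerivAt_eval_log_div p (lt_of_lt_of_le one_pos ht.1)).differentiableAt) hdi
  rw [ArithmeticFunction.sum_Icc_zero_eq a (fun k => f k)] at habel
  have hFI : ∀ t : ℝ, ∑ k ∈ Finset.Icc 0 ⌊t⌋₊, a k = F t := fun t => by
    simpa using ArithmeticFunction.sum_Icc_zero_eq a (fun _ => 1) ⌊t⌋₊
  simp only [hFI] at habel
  have hm : IntegrableOn (fun t : ℝ => (derivative S).eval (Real.log t) / t) (Set.Ioc 1 w) :=
    (((hcont _).div continuousOn_id hne).integrableOn_Icc).mono_set Set.Ioc_subset_Icc_self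
  have hei : IntegrableOn (fun t : ℝ => (derivative p - p).eval (Real.log t) / t ^ 2 * E t)
      (Set.Ioc 1 w) := by
    refine Integrable.mono' (g := fun t => D * C * t ^ (σ - 2)) ?_
      (((hpm _).div (measurable_id.pow_const 2)).mul hEm).aestronglyMeasurable ?_
    · have : IntegrableOn (fun t : ℝ => t ^ (σ - 2)) (Set.Ioi 1) :=
        integrableOn_Ioi_rpow_of_lt (by linarith) one_pos
      exact (this.mono_set Set.Ioc_subset_Ioi_self).const_mul _
    · filter_upwards [ae_restrict_mem measurableSet_Ioc] with t ht
      exact hfE t ht.1.le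
  have hbase : ∫ t in Set.Ioc 1 w, deriv f t * F t = (S.eval (Real.log w) - S.eval 0) +
      ∫ t in Set.Ioc 1 w, (derivative p - p).eval (Real.log t) / t ^ 2 * E t := by
    have h1 : ∫ t in Set.Ioc 1 w, (derivative S).eval (Real.log t) / t
        = S.eval (Real.log w) - S.eval 0 := by
      rw [← intervalIntegral.integral_of_le hw]
      rw [intervalIntegral.integral_eq_sub_of_hasDerivAt
        (f := fun s => S.eval (Real.log s))]
      · simp
      · intro t ht
        rw [Set.uIcc_of_le hw] at ht
        exact hasDerivAt_eval_log S (lt_of_lt_of_le one_pos ht.1)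
      · rw [intervalIntegrable_iff_integrableOn_Ioc_of_le hw]
        exact hm
    rw [← h1, ← integral_add hm hei]
    refine setIntegral_congr_fun measurableSet_Ioc fun t ht => ?_
    have ht0 : t ≠ 0 := (lt_trans one_pos ht.1).ne'
    simp only [hderiv t ht.1.le, hE, hS, derivative_sub, derivative_mul, hq]
    simp only [eval_sub, eval_add, eval_mul]
    field_simp
    ring
  rw [hbase] at habel
  have key : ∑ m ∈ Finset.Ioc 0 ⌊w⌋₊, p.eval (Real.log m) / m * a m - q.eval (Real.log w)
      - (S.eval 0 - I) = p.eval (Real.log w) / w * E w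
        - ((∫ t in Set.Ioc 1 w, (derivative p - p).eval (Real.log t) / t ^ 2 * E t) - I) := by
    have : f w * F w = p.eval (Real.log w) * P.eval (Real.log w)
        + p.eval (Real.log w) / w * E w := by
      simp only [hf, hE]; field_simp; ring
    change ∑ m ∈ Finset.Ioc 0 ⌊w⌋₊, f m * a m - _ - _ = _
    rw [habel, this, hS]
    simp only [eval_sub, eval_mul]
    ring
  rw [key]
  refine (abs_sub _ _).trans ?_
  rw [add_mul]
  refine add_le_add ?_ (hI w hw)
  rw [abs_mul, abs_div, abs_of_pos hw0]
  calc _ ≤ D' * w ^ (σ - θ) / w * (C * w ^ θ) := by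
        gcongr
        exacts [hD' w hw, hC w hw]
    _ = D' * C * ((w ^ (σ - θ) * w ^ θ) / w) := by ring
    _ = _ := by rw [hpow w hw, Real.rpow_sub hw0, Real.rpow_one]

open Polynomial in
theorem Polynomial.exists_derivative_eq (P : ℝ[X]) : ∃ K : ℝ[X], derivative K = P := by
  induction P using Polynomial.induction_on' with
  | add p q hp hq =>
    obtain ⟨K, rfl⟩ := hp
    obtain ⟨L, rfl⟩ := hq
    exact ⟨K + L, derivative_add⟩
  | monomial n a =>
    refine ⟨monomial (n + 1) (a / (n + 1)), ?_⟩
    have : (n : ℝ) + 1 ≠ 0 := by positivity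
    rw [derivative_monomial]
    simp [this]

open Polynomial in
theorem Polynomial.natDegree_eq_of_derivative_eq {P K : ℝ[X]} (hP : P ≠ 0)
    (hK : derivative K = P) : K.natDegree = P.natDegree + 1 := by
  have h0 : K.natDegree ≠ 0 := fun h => hP (by rw [← hK, derivative_of_natDegree_zero h])
  have := natDegree_derivative K
  rw [hK] at this
  omega

open Polynomial in
theorem Polynomial.eval_add_eq_sum_hasseDeriv (P : ℝ[X]) {d : ℕ} (hd : P.natDegree < d)
    (u v : ℝ) : P.eval (u + v) = ∑ j ∈ Finset.range d, (hasseDeriv j P).eval v * u ^ j := by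
  have h := taylor_eval v P u
  rw [← h, eval_eq_sum_range' (by rwa [natDegree_taylor])]
  simp [taylor_coeff]

open Polynomial in
theorem Polynomial.derivative_hasseDeriv (P : ℝ[X]) (j : ℕ) :
    derivative (hasseDeriv j P) = hasseDeriv j (derivative P) := by
  have h1 := LinearMap.congr_fun (hasseDeriv_comp (R := ℝ) 1 j) P
  have h2 := LinearMap.congr_fun (hasseDeriv_comp (R := ℝ) j 1) P
  simp only [LinearMap.comp_apply, hasseDeriv_one] at h1 h2
  rw [h1, h2, add_comm 1 j]
  congr 2
  simp

/-- `∑_{n ≤ N} n ^ (-θ) ≤ N ^ (1 - θ) / (1 - θ)`. -/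
theorem sum_rpow_neg_le {θ : ℝ} (h0 : 0 ≤ θ) (h1 : θ < 1) (N : ℕ) :
    ∑ n ∈ Finset.Ioc 0 N, (n : ℝ) ^ (-θ) ≤ (N : ℝ) ^ (1 - θ) / (1 - θ) := by
  have h1' : 0 < 1 - θ := by linarith
  induction N with
  | zero => simp [Real.zero_rpow h1'.ne']
  | succ N ih =>
    rw [← Finset.insert_Ioc_right_eq_Ioc_add_one (Nat.zero_le _), Finset.sum_insert (by simp)]
    have hN : (0 : ℝ) < (N : ℝ) + 1 := by positivity
    have hb := rpow_one_add_le_one_add_mul_self (s := -1 / ((N : ℝ) + 1))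
      (by rw [le_div_iff₀ hN]; nlinarith [N.cast_nonneg (α := ℝ)]) h1'.le (by linarith)
    have he : (1 + -1 / ((N : ℝ) + 1)) = N / (N + 1) := by field_simp; ring
    rw [he, Real.div_rpow (by positivity) hN.le, div_le_iff₀ (by positivity)] at hb
    have hs : ((N : ℝ) + 1) ^ (-θ) = (N + 1 : ℝ) ^ (1 - θ) / (N + 1) := by
      rw [Real.rpow_sub hN, Real.rpow_neg hN.le, Real.rpow_one]; field_simp
    push_cast
    rw [hs]
    rw [le_div_iff₀ h1'] at ih ⊢
    rw [add_mul]
    have : (1 + (1 - θ) * (-1 / ((N : ℝ) + 1))) * (N + 1 : ℝ) ^ (1 - θ)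
      = (N + 1 : ℝ) ^ (1 - θ) - (N + 1 : ℝ) ^ (1 - θ) / (N + 1) * (1 - θ) := by ring
    linarith

/-- The Dirichlet hyperbola identity for `a * ζ`. -/
theorem sum_mul_zeta_hyperbola (a : ArithmeticFunction ℝ) {x : ℝ} (hx : 1 ≤ x) {N : ℕ}
    (hN : 0 < N) (hNx : (N : ℝ) ≤ x) :
    ∑ n ∈ Finset.Ioc 0 ⌊x⌋₊, (a * (ArithmeticFunction.zeta : ArithmeticFunction ℝ)) n =
      ∑ n ∈ Finset.Ioc 0 N, ∑ m ∈ Finset.Ioc 0 ⌊x / n⌋₊, a m +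
        ∑ m ∈ Finset.Ioc 0 ⌊x / N⌋₊, a m * ((⌊x / m⌋₊ : ℝ) - N) := by
  have hx0 : 0 ≤ x := by linarith
  rw [ArithmeticFunction.sum_Ioc_mul_zeta_eq_sum]
  set M := ⌊x⌋₊ with hM
  have hfl : ∀ m : ℕ, ⌊x / m⌋₊ = M / m := fun m => Nat.floor_div_natCast x m
  simp only [hfl]
  have hNM : N ≤ M := Nat.le_floor hNx
  have h1 : ∀ n ∈ Finset.Ioc 0 N, ∑ m ∈ Finset.Ioc 0 (M / n), a m =
      ∑ m ∈ Finset.Ioc 0 M, if n ≤ M / m then a m else 0 := fun n hn => by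
    rw [← Finset.sum_filter]
    congr 1
    ext m
    simp only [Finset.mem_Ioc, Finset.mem_filter] at hn ⊢
    constructor
    · rintro ⟨h1, h2⟩
      exact ⟨⟨h1, h2.trans (Nat.div_le_self _ _)⟩,
        (Nat.le_div_iff_mul_le h1).2 (by
          rw [mul_comm]; exact (Nat.le_div_iff_mul_le hn.1).1 h2)⟩
    · rintro ⟨⟨h1, -⟩, h2⟩
      exact ⟨h1, (Nat.le_div_iff_mul_le hn.1).2 (by
          rw [mul_comm]; exact (Nat.le_div_iff_mul_le h1).1 h2)⟩
  have h2 : ∑ m ∈ Finset.Ioc 0 (M / N), a m * (((M / m : ℕ) : ℝ) - N) =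
      ∑ m ∈ Finset.Ioc 0 M, if N ≤ M / m then a m * (((M / m : ℕ) : ℝ) - N) else 0 := by
    rw [← Finset.sum_filter]
    congr 1
    ext m
    simp only [Finset.mem_Ioc, Finset.mem_filter]
    constructor
    · rintro ⟨h1, h2⟩
      exact ⟨⟨h1, h2.trans (Nat.div_le_self _ _)⟩,
        (Nat.le_div_iff_mul_le h1).2 (by
          rw [mul_comm]; exact (Nat.le_div_iff_mul_le hN).1 h2)⟩
    · rintro ⟨⟨h1, -⟩, h2⟩
      exact ⟨h1, (Nat.le_div_iff_mul_le hN).2 (by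
          rw [mul_comm]; exact (Nat.le_div_iff_mul_le h1).1 h2)⟩
  rw [Finset.sum_congr rfl h1, h2, Finset.sum_comm, ← Finset.sum_add_distrib]
  refine Finset.sum_congr rfl fun m _ => ?_
  rw [← Finset.sum_filter, Finset.sum_const]
  have h3 : (Finset.Ioc 0 N).filter (fun n => n ≤ M / m) = Finset.Ioc 0 (min N (M / m)) := by
    ext n; simp; omega
  rw [h3, Nat.card_Ioc, Nat.sub_zero, nsmul_eq_mul]
  split_ifs with h
  · rw [min_eq_left h]; ring
  · rw [min_eq_right (by omega)]; ring

theorem hasMainTerm_zeta {θ : ℝ} (hθ : 0 ≤ θ) :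
    HasMainTerm (ArithmeticFunction.zeta : ArithmeticFunction ℝ) 1 θ := by
  refine ⟨1, fun x hx => ?_⟩
  have h : ∑ n ∈ Finset.Ioc 0 ⌊x⌋₊, (ArithmeticFunction.zeta : ArithmeticFunction ℝ) n
      = ⌊x⌋₊ := by
    simp only [ArithmeticFunction.natCoe_apply]
    rw_mod_cast [ArithmeticFunction.sum_Ioc_zeta]
  rw [h, one_mul, Polynomial.eval_one, mul_one, abs_sub_comm,
    abs_of_nonneg (sub_nonneg.2 (Nat.floor_le (by linarith)))]
  have := Nat.lt_floor_add_one x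
  have := Real.one_le_rpow hx hθ
  linarith

open Polynomial in
/-- Asymptotics of `∑_{n ≤ N} P (log x - log n) / n`, uniformly in `x` and `N`. -/
theorem exists_sum_eval_sub_log_div {P K : ℝ[X]} (hK : derivative K = P) {δ : ℝ}
    (hδ : 0 < δ) (hδ1 : δ < 1) :
    ∃ (Γ : ℝ[X]) (C : ℝ), Γ.natDegree ≤ K.natDegree ∧ Γ.coeff K.natDegree = K.leadingCoeff ∧
      0 ≤ C ∧ ∀ (x : ℝ) (N : ℕ), 1 ≤ x → 0 < N →
      |∑ n ∈ Finset.Ioc 0 N, P.eval (Real.log x - Real.log n) / n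
        + K.eval (Real.log x - Real.log N) - Γ.eval (Real.log x)|
        ≤ C * x ^ δ * (N : ℝ) ^ (δ - 1) := by
  have hj : ∀ j : ℕ, ∃ κ C : ℝ, (j = K.natDegree → κ = K.leadingCoeff) ∧ ∀ N : ℕ, 0 < N →
      |∑ n ∈ Finset.Ioc 0 N, (hasseDeriv j P).eval (-Real.log n) / n
        + (hasseDeriv j K).eval (-Real.log N) - κ| ≤ C * (N : ℝ) ^ (δ - 1) := by
    intro j
    by_cases hjd : j = K.natDegree
    · refine ⟨K.leadingCoeff, 0, fun _ => rfl, fun N _ => ?_⟩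
      have h0 : hasseDeriv j P = 0 := by
        rw [← hK, ← derivative_hasseDeriv, hjd, hasseDeriv_natDegree_eq_C, derivative_C]
      rw [h0, hjd, hasseDeriv_natDegree_eq_C]
      simp
    · obtain ⟨κ, C, h⟩ := (hasMainTerm_zeta le_rfl).exists_sum_eval_log_div hδ hδ1
        (p := (hasseDeriv j P).comp (-X)) (q := -(hasseDeriv j K).comp (-X)) (by
          rw [derivative_neg, derivative_comp, derivative_hasseDeriv, hK]
          simp)
      refine ⟨κ, C, fun h => absurd h hjd, fun N hN => ?_⟩
      have := h N (by exact_mod_cast hN)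
      rw [Nat.floor_natCast] at this
      convert this using 2
      rw [eval_neg, sub_neg_eq_add]
      congr 2
      · refine Finset.sum_congr rfl fun n hn => ?_
        have : n ≠ 0 := by simp at hn; omega
        simp [ArithmeticFunction.natCoe_apply, ArithmeticFunction.zeta_apply, this]
      · simp
  choose κ D hκ hD using hj
  set d := K.natDegree with hd
  have hD0 : ∀ j, 0 ≤ D j := fun j => by simpa using (abs_nonneg _).trans (hD j 1 one_pos)
  choose B hB0 hB using fun j : ℕ => exists_abs_eval_log_le (X ^ j) hδ
  refine ⟨∑ j ∈ Finset.range (d + 1), C (κ j) * X ^ j, ∑ j ∈ Finset.range (d + 1), D j * B j,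
    ?_, ?_, Finset.sum_nonneg fun j _ => mul_nonneg (hD0 j) (hB0 j), fun x N hx hN => ?_⟩
  · refine natDegree_sum_le_of_forall_le _ _ fun j hj => ?_
    refine (natDegree_C_mul_X_pow_le _ _).trans ?_
    simp at hj; omega
  · rw [finsetSum_coeff]
    simp only [coeff_C_mul_X_pow]
    rw [Finset.sum_ite_eq]
    simp [hκ d rfl]
  · have hP : P.natDegree < d + 1 := by
      have := natDegree_derivative_le K
      rw [hK] at this; omega
    have e1 : ∑ n ∈ Finset.Ioc 0 N, P.eval (Real.log x - Real.log n) / n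
        = ∑ j ∈ Finset.range (d + 1), (∑ n ∈ Finset.Ioc 0 N,
          (hasseDeriv j P).eval (-Real.log n) / n) * Real.log x ^ j := by
      simp_rw [Finset.sum_mul]
      rw [Finset.sum_comm]
      refine Finset.sum_congr rfl fun n _ => ?_
      rw [sub_eq_add_neg, eval_add_eq_sum_hasseDeriv P hP, Finset.sum_div]
      exact Finset.sum_congr rfl fun j _ => by ring
    have e2 : K.eval (Real.log x - Real.log N) = ∑ j ∈ Finset.range (d + 1),
        (hasseDeriv j K).eval (-Real.log N) * Real.log x ^ j := by
      rw [sub_eq_add_neg, eval_add_eq_sum_hasseDeriv K (Nat.lt_succ_self _)]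
    rw [e1, e2, eval_finsetSum, ← Finset.sum_add_distrib, ← Finset.sum_sub_distrib,
      Finset.sum_mul, Finset.sum_mul]
    refine (Finset.abs_sum_le_sum_abs _ _).trans (Finset.sum_le_sum fun j _ => ?_)
    have hb := hB j x hx
    rw [eval_pow, eval_X] at hb
    rw [eval_C_mul, eval_pow, eval_X, ← add_mul, ← sub_mul, abs_mul]
    calc _ ≤ D j * (N : ℝ) ^ (δ - 1) * (B j * x ^ δ) := by
          gcongr
          · exact mul_nonneg (hD0 j) (by positivity)
          · exact hD j N hN
      _ = _ := by ring

open Polynomial in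
set_option maxHeartbeats 800000 in
/-- Convolution with `ζ` raises the degree of the main term by one and worsens the exponent of
the error term in a controlled way. -/
theorem HasMainTerm.mul_zeta {a : ArithmeticFunction ℝ} {P : ℝ[X]} {θ θ' c : ℝ}
    (h : HasMainTerm a P θ) (ha : ∀ n, 0 ≤ a n) (hP : P ≠ 0) (hθ0 : 0 ≤ θ) (hc0 : 0 < c)
    (hc : c < θ') (hθ' : θ' < 1) (hcθ : 1 - (1 - θ) * c < θ') :
    ∃ Q : ℝ[X], Q.natDegree = P.natDegree + 1 ∧
      HasMainTerm (a * (ArithmeticFunction.zeta : ArithmeticFunction ℝ)) Q θ' := by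
  have hc1 : c < 1 := hc.trans hθ'
  have hθ1 : θ < 1 := by nlinarith
  obtain ⟨K, hK⟩ := exists_derivative_eq P
  have hKd := natDegree_eq_of_derivative_eq hP hK
  set δ := (θ' - c) / 2 with hδ
  have hδ0 : 0 < δ := by simp only [hδ]; linarith
  have hδ1 : δ < 1 := by simp only [hδ]; linarith
  have h2δ : 2 * δ = θ' - c := by simp only [hδ]; ring
  have hcδ := mul_pos hc0 hδ0
  have hcδ' := mul_pos (sub_pos.2 hc1) hδ0
  have e1 : θ + (1 - c) * (1 - θ) ≤ θ' := by linarith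
  have e2 : 1 + δ + (1 - c) * (δ - 1) ≤ θ' := by linarith
  have e3 : c * (1 + δ) ≤ θ' := by linarith
  clear_value δ
  set σ := 1 - (1 - θ') / c with hσ
  have hσc : (1 - σ) * c = 1 - θ' := by simp only [hσ]; field_simp; ring
  have hσ1 : σ < 1 := by nlinarith
  have hθσ : θ < σ := by nlinarith
  obtain ⟨Γ, C₂, hΓd, hΓc, hC₂, hΓ⟩ := exists_sum_eval_sub_log_div hK hδ0 hδ1
  obtain ⟨κ, C₃, hκ⟩ := h.exists_sum_eval_log_div hθσ hσ1 (p := 1) (q := K + P) (by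
    rw [derivative_add, hK, mul_one])
  have hC₃ : 0 ≤ C₃ := by simpa using (abs_nonneg _).trans (hκ 1 le_rfl)
  obtain ⟨C₅, hC₅, hPl⟩ := exists_abs_eval_log_le P hδ0
  obtain ⟨C, hC⟩ := h
  have hC0 : 0 ≤ C := by simpa using (abs_nonneg _).trans (hC 1 le_rfl)
  refine ⟨Γ + Polynomial.C κ, ?_, C * (1 / (1 - θ)) + 2 * C₂ + C₃ + C + (C₅ + C) * 4,
    fun x hx => ?_⟩
  · rw [natDegree_add_C, ← hKd]
    refine le_antisymm hΓd (le_natDegree_of_ne_zero ?_)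
    rw [hΓc, leadingCoeff_ne_zero]
    rintro rfl
    simp at hKd
  have hx0 : 0 < x := by linarith
  set F : ℝ → ℝ := fun x => ∑ n ∈ Finset.Ioc 0 ⌊x⌋₊, a n with hF
  set u := x ^ (1 - c) with hu
  have hu1 : 1 ≤ u := Real.one_le_rpow hx (by linarith)
  set N := ⌊u⌋₊ with hN
  have hN0 : 0 < N := Nat.floor_pos.2 hu1
  have hN0' : (0 : ℝ) < N := by exact_mod_cast hN0
  have hN1 : (1 : ℝ) ≤ N := by exact_mod_cast hN0
  have hNu : (N : ℝ) ≤ u := Nat.floor_le (by linarith)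
  have huN : u ≤ 2 * N := by have := (Nat.lt_floor_add_one u).le; linarith
  have hux : u ≤ x := by
    simpa using Real.rpow_le_rpow_of_exponent_le hx (show 1 - c ≤ 1 by linarith)
  have hxc : x ^ c * u = x := by
    rw [hu, ← Real.rpow_add hx0, add_sub_cancel, Real.rpow_one]
  have hxc1 : 1 ≤ x ^ c := Real.one_le_rpow hx hc0.le
  set y := x / N with hy
  have hNy : N * y = x := by simp only [hy]; field_simp
  have hyl : x ^ c ≤ y := by
    rw [hy, le_div_iff₀ hN0']
    calc x ^ c * N ≤ x ^ c * u := by gcongr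
      _ = x := hxc
  have hyu : y ≤ 2 * x ^ c := by
    rw [hy, div_le_iff₀ hN0']
    nlinarith
  have hy1 : 1 ≤ y := hxc1.trans hyl
  have hy0 : 0 < y := by linarith
  have hlog : Real.log y = Real.log x - Real.log N := Real.log_div hx0.ne' hN0'.ne'
  set L := Real.log x with hL
  -- the terms with small second factor
  have hT1 : |∑ n ∈ Finset.Ioc 0 N, F (x / n)
      - x * ∑ n ∈ Finset.Ioc 0 N, P.eval (L - Real.log n) / n| ≤ C * (1 / (1 - θ)) * x ^ θ' := by
    rw [Finset.mul_sum, ← Finset.sum_sub_distrib]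
    calc _ ≤ ∑ n ∈ Finset.Ioc 0 N, C * x ^ θ * (n : ℝ) ^ (-θ) := by
          refine (Finset.abs_sum_le_sum_abs _ _).trans (Finset.sum_le_sum fun n hn => ?_)
          rw [Finset.mem_Ioc] at hn
          have hn0 : (0 : ℝ) < n := by exact_mod_cast hn.1
          have hnx : (n : ℝ) ≤ x := (Nat.cast_le.2 hn.2).trans (hNu.trans hux)
          have := hC (x / n) ((one_le_div hn0).2 hnx)
          rw [Real.log_div hx0.ne' hn0.ne', Real.div_rpow hx0.le hn0.le] at this
          rw [Real.rpow_neg hn0.le]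
          calc _ = |F (x / n) - x / n * P.eval (L - Real.log n)| := by congr 1; ring
            _ ≤ _ := this
            _ = _ := by ring
      _ ≤ C * x ^ θ * ((N : ℝ) ^ (1 - θ) / (1 - θ)) := by
          rw [← Finset.mul_sum]
          gcongr
          exact sum_rpow_neg_le hθ0 hθ1 N
      _ ≤ C * x ^ θ * (u ^ (1 - θ) / (1 - θ)) := by
          have : 0 ≤ 1 - θ := by linarith
          gcongr
      _ = C * (1 / (1 - θ)) * x ^ (θ + (1 - c) * (1 - θ)) := by
          rw [hu, ← Real.rpow_mul hx0.le, Real.rpow_add hx0]; ring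
      _ ≤ _ := by
          have : 0 ≤ 1 - θ := by linarith
          gcongr
  have hT2 : |x * (∑ n ∈ Finset.Ioc 0 N, P.eval (L - Real.log n) / n
      + K.eval (Real.log y) - Γ.eval L)| ≤ 2 * C₂ * x ^ θ' := by
    have hNd : (N : ℝ) ^ (δ - 1) ≤ 2 * x ^ ((1 - c) * (δ - 1)) := by
      calc (N : ℝ) ^ (δ - 1) ≤ (u / 2) ^ (δ - 1) :=
            Real.rpow_le_rpow_of_nonpos (by linarith) (by linarith) (by linarith)
        _ = 2 ^ (1 - δ) * u ^ (δ - 1) := by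
            rw [Real.div_rpow (by linarith) (by norm_num), div_eq_mul_inv,
              ← Real.rpow_neg (by norm_num), neg_sub, mul_comm]
        _ ≤ 2 ^ (1 : ℝ) * u ^ (δ - 1) := by
            gcongr
            · norm_num
            · linarith
        _ = _ := by rw [hu, ← Real.rpow_mul hx0.le, Real.rpow_one]
    rw [abs_mul, abs_of_pos hx0, hlog]
    calc _ ≤ x * (C₂ * x ^ δ * (2 * x ^ ((1 - c) * (δ - 1)))) := by
          refine mul_le_mul_of_nonneg_left ((hΓ x N hx hN0).trans ?_) hx0.le
          gcongr
      _ = 2 * C₂ * x ^ (1 + δ + (1 - c) * (δ - 1)) := by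
          rw [Real.rpow_add hx0, Real.rpow_add hx0, Real.rpow_one]; ring
      _ ≤ _ := by
          gcongr
  have hT3 : |x * (∑ m ∈ Finset.Ioc 0 ⌊y⌋₊, 1 / (m : ℝ) * a m - (K + P).eval (Real.log y) - κ)|
      ≤ C₃ * x ^ θ' := by
    rw [abs_mul, abs_of_pos hx0]
    have := hκ y hy1
    simp only [eval_one] at this
    calc _ ≤ x * (C₃ * (x ^ c) ^ (σ - 1)) := by
          refine mul_le_mul_of_nonneg_left (this.trans ?_) hx0.le
          refine mul_le_mul_of_nonneg_left ?_ hC₃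
          exact Real.rpow_le_rpow_of_nonpos (by linarith) hyl (by linarith)
      _ = C₃ * x ^ (1 + c * (σ - 1)) := by
          rw [← Real.rpow_mul hx0.le, Real.rpow_add hx0, Real.rpow_one]; ring
      _ = _ := by congr 2; linarith
  have hT4 : |N * (F y - y * P.eval (Real.log y))| ≤ C * x ^ θ' := by
    rw [abs_mul, abs_of_pos hN0']
    calc _ ≤ N * (C * y ^ θ) := mul_le_mul_of_nonneg_left (hC y hy1) hN0'.le
      _ = C * (x * y ^ (θ - 1)) := by
          rw [Real.rpow_sub hy0, Real.rpow_one, ← hNy]; field_simp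
      _ ≤ C * (x * (x ^ c) ^ (θ - 1)) := by
          refine mul_le_mul_of_nonneg_left (mul_le_mul_of_nonneg_left ?_ hx0.le) hC0
          exact Real.rpow_le_rpow_of_nonpos (by linarith) hyl (by linarith)
      _ = C * x ^ (1 + c * (θ - 1)) := by
          rw [← Real.rpow_mul hx0.le, Real.rpow_add hx0, Real.rpow_one]
      _ ≤ _ := by
          gcongr
          linarith
  have hFy : F y ≤ (C₅ + C) * 4 * x ^ θ' := by
    have h1 : F y ≤ |F y - y * P.eval (Real.log y)| + y * |P.eval (Real.log y)| := by
      have h2 := le_abs_self (F y - y * P.eval (Real.log y))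
      have h3 := mul_le_mul_of_nonneg_left (le_abs_self (P.eval (Real.log y))) hy0.le
      linarith
    calc F y ≤ C * y ^ θ + y * (C₅ * y ^ δ) := h1.trans (add_le_add (hC y hy1) (by
          gcongr; exact hPl y hy1))
      _ ≤ C * y ^ (1 + δ) + C₅ * y ^ (1 + δ) := by
          refine add_le_add ?_ (le_of_eq ?_)
          · gcongr
            linarith
          · rw [Real.rpow_add hy0, Real.rpow_one]; ring
      _ = (C₅ + C) * y ^ (1 + δ) := by ring
      _ ≤ (C₅ + C) * (2 * x ^ c) ^ (1 + δ) := by gcongr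
      _ = (C₅ + C) * (2 ^ (1 + δ) * x ^ (c * (1 + δ))) := by
          rw [Real.mul_rpow (by norm_num) (by positivity), ← Real.rpow_mul hx0.le]
      _ ≤ (C₅ + C) * (2 ^ (2 : ℝ) * x ^ θ') := by
          gcongr
          · norm_num
          · linarith
      _ = _ := by norm_num; ring
  have hT5 : |∑ m ∈ Finset.Ioc 0 ⌊y⌋₊, a m * ((⌊x / m⌋₊ : ℝ) - x / m)|
      ≤ (C₅ + C) * 4 * x ^ θ' := by
    refine le_trans ?_ hFy
    refine (Finset.abs_sum_le_sum_abs _ _).trans (Finset.sum_le_sum fun m _ => ?_)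
    rw [abs_mul, abs_of_nonneg (ha m)]
    refine mul_le_of_le_one_right (ha m) ?_
    rw [abs_le]
    have h1 := Nat.floor_le (show 0 ≤ x / m by positivity)
    have h2 := Nat.lt_floor_add_one (x / m)
    constructor <;> linarith
  have hsum : ∑ m ∈ Finset.Ioc 0 ⌊y⌋₊, a m * ((⌊x / m⌋₊ : ℝ) - N) =
      ∑ m ∈ Finset.Ioc 0 ⌊y⌋₊, a m * ((⌊x / m⌋₊ : ℝ) - x / m)
        + x * ∑ m ∈ Finset.Ioc 0 ⌊y⌋₊, 1 / (m : ℝ) * a m - N * F y := by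
    simp only [hF, Finset.mul_sum]
    rw [← Finset.sum_add_distrib, ← Finset.sum_sub_distrib]
    exact Finset.sum_congr rfl fun m _ => by ring
  have key := sum_mul_zeta_hyperbola a hx hN0 (hNu.trans hux)
  rw [hsum] at key
  have hdecomp : ∑ n ∈ Finset.Ioc 0 ⌊x⌋₊,
      (a * (ArithmeticFunction.zeta : ArithmeticFunction ℝ)) n - x * (Γ + Polynomial.C κ).eval L
      = (∑ n ∈ Finset.Ioc 0 N, F (x / n)
          - x * ∑ n ∈ Finset.Ioc 0 N, P.eval (L - Real.log n) / n)
        + x * (∑ n ∈ Finset.Ioc 0 N, P.eval (L - Real.log n) / n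
            + K.eval (Real.log y) - Γ.eval L)
        + x * (∑ m ∈ Finset.Ioc 0 ⌊y⌋₊, 1 / (m : ℝ) * a m - (K + P).eval (Real.log y) - κ)
        - N * (F y - y * P.eval (Real.log y))
        + ∑ m ∈ Finset.Ioc 0 ⌊y⌋₊, a m * ((⌊x / m⌋₊ : ℝ) - x / m) := by
    have h1 : (N : ℝ) * (F y - y * P.eval (Real.log y))
        = N * F y - x * P.eval (Real.log y) := by rw [← hNy]; ring
    rw [key, h1, eval_add, eval_C, eval_add]
    ring
  rw [hdecomp]
  generalize ∑ n ∈ Finset.Ioc 0 N, F (x / n)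
          - x * ∑ n ∈ Finset.Ioc 0 N, P.eval (L - Real.log n) / n = T₁ at *
  rw [abs_le] at *
  constructor <;> linarith [hT1.1, hT1.2, hT2.1, hT2.2, hT3.1, hT3.2, hT4.1, hT4.2, hT5.1, hT5.2]

open Polynomial in
/-- The summatory function of `ζ ^ k` has a main term of degree `k - 1`, with error exponent
`1 - 1 / (2 * k)`. -/
theorem exists_hasMainTerm_zeta_pow (k : ℕ) :
    ∃ P : ℝ[X], P ≠ 0 ∧ P.natDegree = k ∧
      HasMainTerm ((ArithmeticFunction.zeta : ArithmeticFunction ℝ) ^ (k + 1)) P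
        (1 - 1 / (2 * (k + 1))) := by
  have hnn : ∀ k n : ℕ, 0 ≤ ((ArithmeticFunction.zeta : ArithmeticFunction ℝ) ^ k) n := by
    intro k
    induction k with
    | zero => intro n; simp only [pow_zero, ArithmeticFunction.one_apply]; split_ifs <;> norm_num
    | succ k ih =>
      intro n
      rw [pow_succ, ArithmeticFunction.mul_apply]
      refine Finset.sum_nonneg fun d _ => mul_nonneg (ih _) ?_
      rw [ArithmeticFunction.natCoe_apply]
      positivity
  induction k with
  | zero =>
    refine ⟨1, one_ne_zero, natDegree_one, ?_⟩
    rw [zero_add, pow_one]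
    exact hasMainTerm_zeta (by norm_num)
  | succ k ih =>
    obtain ⟨P, hP, hd, h⟩ := ih
    have hk : (0 : ℝ) ≤ k := k.cast_nonneg
    have hk1 : (0 : ℝ) < k + 1 := by positivity
    have hk2 : (0 : ℝ) < k + 2 := by positivity
    obtain ⟨Q, hQd, hQ⟩ := h.mul_zeta (θ' := 1 - 1 / (2 * (k + 2)))
      (c := 1 - 3 / (4 * (k + 2))) (hnn _) hP
      (by rw [sub_nonneg, div_le_one (by positivity)]; linarith)
      (by rw [sub_pos, div_lt_one (by positivity)]; linarith)
      (by
        rw [sub_lt_sub_iff_left, div_lt_div_iff₀ (by positivity) (by positivity)]; nlinarith)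
      (by rw [sub_lt_self_iff]; positivity)
      (by
        have : 1 - (1 - (1 - 1 / (2 * ((k : ℝ) + 1)))) * (1 - 3 / (4 * (k + 2)))
            = 1 - (4 * k + 5) / (8 * (k + 1) * (k + 2)) := by field_simp; ring
        rw [this, sub_lt_sub_iff_left, div_lt_div_iff₀ (by positivity) (by positivity)]
        nlinarith)
    refine ⟨Q, ?_, by rw [hQd, hd], ?_⟩
    · rintro rfl
      simp at hQd
    · rw [pow_succ]
      push_cast
      convert hQ using 3
      ring

open Polynomial in
/-- The error estimate in `HasMainTerm` extends to all positive reals. -/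
theorem HasMainTerm.exists_forall_pos {a : ArithmeticFunction ℝ} {P : ℝ[X]} {θ : ℝ}
    (h : HasMainTerm a P θ) (hθ : θ < 1) : ∃ C : ℝ, 0 ≤ C ∧ ∀ x : ℝ, 0 < x →
    |∑ n ∈ Finset.Ioc 0 ⌊x⌋₊, a n - x * P.eval (Real.log x)| ≤ C * x ^ θ := by
  obtain ⟨C, hC⟩ := h
  obtain ⟨D, hD0, hD⟩ := exists_abs_eval_log_le (P.comp (-X)) (sub_pos.2 hθ)
  refine ⟨max C D, le_max_of_le_right hD0, fun x hx => ?_⟩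
  rcases le_or_gt 1 x with h1 | h1
  · exact (hC x h1).trans (by gcongr; exact le_max_left _ _)
  · have h2 := hD x⁻¹ ((one_le_inv₀ hx).2 h1.le)
    rw [eval_comp, Real.log_inv, eval_neg, eval_X, neg_neg] at h2
    rw [Nat.floor_eq_zero.2 h1, Finset.Ioc_self, Finset.sum_empty, zero_sub, abs_neg, abs_mul,
      abs_of_pos hx]
    calc x * |P.eval (Real.log x)| ≤ x * (D * x⁻¹ ^ (1 - θ)) := by gcongr
      _ = D * x ^ θ := by
        rw [Real.inv_rpow hx.le, Real.rpow_sub hx, Real.rpow_one]; field_simp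
      _ ≤ _ := by gcongr; exact le_max_right _ _

/-- Weighting an absolutely convergent Dirichlet series by a polynomial in `log m`. -/
theorem summable_mul_eval_log {h : ℕ → ℝ} {θ : ℝ} (hθ : θ < 1)
    (hs : Summable fun n : ℕ => |h n| * (n : ℝ) ^ (-θ)) (p : Polynomial ℝ) :
    Summable fun m : ℕ => h m / m * p.eval (Real.log m) := by
  obtain ⟨D, hD0, hD⟩ := exists_abs_eval_log_le p (sub_pos.2 hθ)
  refine Summable.of_norm_bounded (hs.mul_left D) fun m => ?_
  rcases Nat.eq_zero_or_pos m with rfl | hm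
  · simp; positivity
  · have hm0 : (0 : ℝ) < m := by exact_mod_cast hm
    rw [norm_mul, norm_div, Real.norm_eq_abs, Real.norm_eq_abs, Real.norm_eq_abs,
      abs_of_pos hm0]
    calc _ ≤ |h m| / m * (D * (m : ℝ) ^ (1 - θ)) := by
          gcongr
          exact hD m (by exact_mod_cast hm)
      _ = _ := by
          rw [Real.rpow_sub hm0, Real.rpow_neg hm0.le, Real.rpow_one]; field_simp

open Polynomial in
/-- Convolution with an absolutely convergent Dirichlet series preserves `HasMainTerm`. -/
theorem HasMainTerm.mul_of_summable {a h : ArithmeticFunction ℝ} {P : ℝ[X]} {θ : ℝ}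
    (hm : HasMainTerm a P θ) (hθ : θ < 1)
    (hs : Summable fun n : ℕ => |h n| * (n : ℝ) ^ (-θ)) :
    ∃ Q : ℝ[X], Q.natDegree ≤ P.natDegree ∧
      Q.coeff P.natDegree = P.leadingCoeff * ∑' m : ℕ, h m / m ∧ HasMainTerm (h * a) Q θ := by
  obtain ⟨C₀, hC0, hC⟩ := hm.exists_forall_pos hθ
  set d := P.natDegree with hd
  set γ : ℕ → ℝ := fun j => ∑' m : ℕ, h m / m * ((hasseDeriv j P).comp (-X)).eval (Real.log m)
    with hγ
  have hγs : ∀ j, HasSum (fun m : ℕ => h m / m * (hasseDeriv j P).eval (-Real.log m)) (γ j) :=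
    fun j => by
      have := (summable_mul_eval_log hθ hs ((hasseDeriv j P).comp (-X))).hasSum
      simpa [hγ] using this
  refine ⟨∑ j ∈ Finset.range (d + 1), C (γ j) * X ^ j, ?_, ?_,
    C₀ * ∑' n : ℕ, |h n| * (n : ℝ) ^ (-θ), fun x hx => ?_⟩
  · refine natDegree_sum_le_of_forall_le _ _ fun j hj => ?_
    refine (natDegree_C_mul_X_pow_le _ _).trans ?_
    simp at hj; omega
  · rw [finsetSum_coeff]
    simp only [coeff_C_mul_X_pow]
    rw [Finset.sum_ite_eq, if_pos (by simp), hγ]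
    simp only [hd, hasseDeriv_natDegree_eq_C, C_comp, eval_C]
    rw [tsum_mul_right, mul_comm]
  · have hx0 : 0 < x := by linarith
    set F : ℝ → ℝ := fun x => ∑ n ∈ Finset.Ioc 0 ⌊x⌋₊, a n with hF
    have h1 : HasSum (fun m : ℕ => h m * F (x / m)) (∑ n ∈ Finset.Ioc 0 ⌊x⌋₊, (h * a) n) := by
      rw [ArithmeticFunction.sum_Ioc_mul_eq_sum_sum]
      have : ∀ m : ℕ, F (x / m) = ∑ n ∈ Finset.Ioc 0 (⌊x⌋₊ / m), a n := fun m => by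
        simp only [hF, Nat.floor_div_natCast]
      simp only [this]
      refine hasSum_sum_of_ne_finset_zero fun m hm => ?_
      simp only [Finset.mem_Ioc, not_and_or, not_lt, not_le, Nat.le_zero] at hm
      rcases hm with rfl | hm
      · simp
      · rw [Nat.div_eq_of_lt hm]; simp
    have h2 : HasSum (fun m : ℕ => h m * (x / m * P.eval (Real.log x - Real.log m)))
        (x * (∑ j ∈ Finset.range (d + 1), C (γ j) * X ^ j).eval (Real.log x)) := by
      have := (hasSum_sum (s := Finset.range (d + 1)) fun j _ =>
        (hγs j).mul_right (Real.log x ^ j)).mul_left x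
      have e : (∑ j ∈ Finset.range (d + 1), C (γ j) * X ^ j).eval (Real.log x)
          = ∑ j ∈ Finset.range (d + 1), γ j * Real.log x ^ j := by simp [eval_finsetSum]
      rw [e]
      have e' : (fun m : ℕ => h m * (x / m * P.eval (Real.log x - Real.log m))) = fun m : ℕ =>
          x * ∑ j ∈ Finset.range (d + 1),
            h m / m * (hasseDeriv j P).eval (-Real.log m) * Real.log x ^ j := by
        funext m
        rw [sub_eq_add_neg, eval_add_eq_sum_hasseDeriv P (Nat.lt_succ_self _),
          Finset.mul_sum, Finset.mul_sum, Finset.mul_sum]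
        exact Finset.sum_congr rfl fun j _ => by ring
      rw [e']
      exact this
    have h3 := h1.sub h2
    rw [← h3.tsum_eq, mul_assoc, mul_comm _ (x ^ θ), ← mul_assoc, ← tsum_mul_left,
      ← Real.norm_eq_abs]
    refine tsum_of_norm_bounded (hs.mul_left (C₀ * x ^ θ)).hasSum fun m => ?_
    rcases Nat.eq_zero_or_pos m with rfl | hm
    · simp
    · have hm0 : (0 : ℝ) < m := by exact_mod_cast hm
      have h4 := hC (x / m) (by positivity)
      rw [Real.log_div hx0.ne' hm0.ne', Real.div_rpow hx0.le hm0.le] at h4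
      rw [← mul_sub, norm_mul, Real.norm_eq_abs, Real.norm_eq_abs]
      calc _ ≤ |h m| * (C₀ * (x ^ θ / (m : ℝ) ^ θ)) := by gcongr
        _ = _ := by rw [Real.rpow_neg hm0.le]; field_simp

open ArithmeticFunction in
theorem moebius_mul_apply_prime_pow_succ (g : ArithmeticFunction ℝ) {p : ℕ} (hp : p.Prime)
    (k : ℕ) :
    ((moebius : ArithmeticFunction ℝ) * g) (p ^ (k + 1)) = g (p ^ (k + 1)) - g (p ^ k) := by
  have h : ∀ k, g (p ^ k) = ∑ i ∈ Finset.range (k + 1),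
      ((moebius : ArithmeticFunction ℝ) * g) (p ^ i) := fun k => by
    rw [← Nat.sum_divisors_prime_pow hp, ← coe_zeta_mul_apply, ← mul_assoc,
      coe_zeta_mul_coe_moebius, one_mul]
  rw [h (k + 1), h k, Finset.sum_range_succ _ (k + 1)]
  ring

/-- The size condition on the values at higher prime powers which makes the Dirichlet series
converge absolutely beyond `11 / 12` up to the contribution of the primes. -/
def PrimePowBound (g : ArithmeticFunction ℝ) (C : ℝ) : Prop :=
  ∀ p k : ℕ, p.Prime → 2 ≤ k →
    |g (p ^ k)| ≤ C * ((k : ℝ) + 1) ^ 2 * (p : ℝ) ^ ((6 * k / 7 - 1 : ℝ))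

theorem summable_sq_mul_two_rpow :
    Summable fun k : ℕ => ((k : ℝ) + 3) ^ 2 * ((2 : ℝ) ^ (-(5 / 84) : ℝ)) ^ k := by
  set ρ : ℝ := (2 : ℝ) ^ (-(5 / 84) : ℝ) with hρ
  have h0 : 0 < ρ := by positivity
  have h1 : ‖ρ‖ < 1 := by
    rw [Real.norm_of_nonneg h0.le]
    exact Real.rpow_lt_one_of_one_lt_of_neg (by norm_num) (by norm_num)
  have h := fun k => summable_pow_mul_geometric_of_norm_lt_one (R := ℝ) k h1
  refine (((h 2).add ((h 1).mul_left 6)).add ((h 0).mul_left 9)).congr fun k => ?_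
  ring

/-- The part of an Euler factor at `s ≥ 11 / 12` coming from exponents at least two. -/
theorem PrimePowBound.exists_tail_bound {g : ArithmeticFunction ℝ} {C : ℝ}
    (hg : PrimePowBound g C) : ∃ T : ℝ, 0 ≤ T ∧ ∀ s : ℝ, 11 / 12 ≤ s → ∀ p : ℕ, p.Prime →
      (Summable fun k : ℕ => |g (p ^ (k + 2))| * ((p ^ (k + 2) : ℕ) : ℝ) ^ (-s)) ∧
      ∑' k : ℕ, |g (p ^ (k + 2))| * ((p ^ (k + 2) : ℕ) : ℝ) ^ (-s)
        ≤ T * (p : ℝ) ^ (-(47 / 42) : ℝ) := by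
  have hC : 0 ≤ C := by
    by_contra hC
    have := (abs_nonneg _).trans (hg 2 2 Nat.prime_two le_rfl)
    refine absurd this (not_le.2 ?_)
    rw [mul_assoc]
    exact mul_neg_of_neg_of_pos (not_le.1 hC) (by positivity)
  refine ⟨C * ∑' k : ℕ, ((k : ℝ) + 3) ^ 2 * ((2 : ℝ) ^ (-(5 / 84) : ℝ)) ^ k,
    mul_nonneg hC (tsum_nonneg fun k => by positivity), fun s hs p hp => ?_⟩
  have hp1 : (1 : ℝ) ≤ p := by exact_mod_cast hp.one_lt.le
  have hp2 : (2 : ℝ) ≤ p := by exact_mod_cast hp.two_le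
  have hp0 : (0 : ℝ) < p := by linarith
  have hle : ∀ k : ℕ, |g (p ^ (k + 2))| * ((p ^ (k + 2) : ℕ) : ℝ) ^ (-s) ≤
      C * (p : ℝ) ^ (-(47 / 42) : ℝ) * (((k : ℝ) + 3) ^ 2 * ((2 : ℝ) ^ (-(5 / 84) : ℝ)) ^ k) := by
    intro k
    have h1 := hg p (k + 2) hp (by omega)
    have h2 : ((p ^ (k + 2) : ℕ) : ℝ) ^ (-s) = (p : ℝ) ^ (-(s * (k + 2))) := by
      push_cast
      rw [← Real.rpow_natCast, ← Real.rpow_mul hp0.le]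
      congr 1; push_cast; ring
    have h3 : (p : ℝ) ^ (-(5 / 84) * (k : ℝ)) ≤ ((2 : ℝ) ^ (-(5 / 84) : ℝ)) ^ k := by
      rw [← Real.rpow_natCast, ← Real.rpow_mul (by norm_num)]
      refine Real.rpow_le_rpow_of_nonpos (by norm_num) hp2 ?_
      have : (0 : ℝ) ≤ k := k.cast_nonneg
      nlinarith
    rw [h2]
    calc _ ≤ C * (((k + 2 : ℕ) : ℝ) + 1) ^ 2 * (p : ℝ) ^ ((6 * ((k + 2 : ℕ) : ℝ) / 7 - 1 : ℝ))
          * (p : ℝ) ^ (-(s * (k + 2))) := by gcongr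
      _ = C * ((k : ℝ) + 3) ^ 2 * (p : ℝ) ^
          ((6 * ((k + 2 : ℕ) : ℝ) / 7 - 1 : ℝ) + -(s * (k + 2))) := by
          rw [Real.rpow_add hp0]; push_cast; ring
      _ ≤ C * ((k : ℝ) + 3) ^ 2 * (p : ℝ) ^ (-(47 / 42) + -(5 / 84) * (k : ℝ)) := by
          refine mul_le_mul_of_nonneg_left (Real.rpow_le_rpow_of_exponent_le hp1 ?_)
            (by positivity)
          push_cast
          have : (0 : ℝ) ≤ k := k.cast_nonneg
          nlinarith
      _ ≤ C * ((k : ℝ) + 3) ^ 2 * ((p : ℝ) ^ (-(47 / 42) : ℝ)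
          * ((2 : ℝ) ^ (-(5 / 84) : ℝ)) ^ k) := by
          rw [Real.rpow_add hp0]; gcongr
      _ = _ := by ring
  have hsum := summable_sq_mul_two_rpow.mul_left (C * (p : ℝ) ^ (-(47 / 42) : ℝ))
  have hsm := hsum.of_nonneg_of_le (fun k => by positivity) hle
  refine ⟨hsm, (hsm.tsum_le_tsum hle hsum).trans (le_of_eq ?_)⟩
  rw [tsum_mul_left]; ring

theorem PrimePowBound.summable {g : ArithmeticFunction ℝ} {C : ℝ} (hg : PrimePowBound g C)
    {s : ℝ} (hs : 11 / 12 ≤ s) {p : ℕ} (hp : p.Prime) :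
    Summable fun k : ℕ => |g (p ^ k)| * ((p ^ k : ℕ) : ℝ) ^ (-s) := by
  obtain ⟨T, -, hT⟩ := hg.exists_tail_bound
  exact (summable_nat_add_iff 2).1 (hT s hs p hp).1

theorem PrimePowBound.summable_div {g : ArithmeticFunction ℝ} {C : ℝ} (hg : PrimePowBound g C)
    {p : ℕ} (hp : p.Prime) : Summable fun k : ℕ => g (p ^ k) / ((p ^ k : ℕ) : ℝ) := by
  refine Summable.of_norm ((hg.summable (s := 1) (by norm_num) hp).congr fun k => ?_)
  rw [Real.rpow_neg_one, norm_div, Real.norm_eq_abs, RCLike.norm_natCast, div_eq_mul_inv]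

/-- A multiplicative function with constant value `c` at the primes, controlled values at higher
prime powers and positive Euler factors at `s = 1`. -/
structure EulerData (g : ArithmeticFunction ℝ) (c C : ℝ) : Prop where
  isMultiplicative : g.IsMultiplicative
  apply_prime : ∀ p : ℕ, p.Prime → g p = c
  primePowBound : PrimePowBound g C
  factor_pos : ∀ p : ℕ, p.Prime → 0 < ∑' k : ℕ, g (p ^ k) / ((p ^ k : ℕ) : ℝ)

open ArithmeticFunction in
theorem EulerData.moebius_mul {g : ArithmeticFunction ℝ} {c C : ℝ} (hg : EulerData g c C)
    (hcC : |c| ≤ C) : EulerData ((moebius : ArithmeticFunction ℝ) * g) (c - 1) (2 * C) := by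
  have hC : 0 ≤ C := (abs_nonneg c).trans hcC
  have hmul : ((moebius : ArithmeticFunction ℝ) * g).IsMultiplicative :=
    isMultiplicative_moebius.intCast.mul hg.isMultiplicative
  have hb : PrimePowBound ((moebius : ArithmeticFunction ℝ) * g) (2 * C) := by
    intro p k hp hk
    obtain ⟨k, rfl⟩ := Nat.exists_eq_add_of_le' hk
    have hp1 : (1 : ℝ) ≤ p := by exact_mod_cast hp.one_lt.le
    have hk0 : (0 : ℝ) ≤ k := k.cast_nonneg
    rw [moebius_mul_apply_prime_pow_succ g hp (k + 1)]
    have h1 := hg.primePowBound p (k + 2) hp (by omega)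
    have h2 : |g (p ^ (k + 1))| ≤ C * (((k + 2 : ℕ) : ℝ) + 1) ^ 2
        * (p : ℝ) ^ ((6 * ((k + 2 : ℕ) : ℝ) / 7 - 1 : ℝ)) := by
      rcases Nat.eq_zero_or_pos k with rfl | hk
      · rw [zero_add, pow_one, hg.apply_prime p hp]
        refine hcC.trans ?_
        rw [mul_assoc]
        refine le_mul_of_one_le_right hC (one_le_mul_of_one_le_of_one_le ?_ ?_)
        · norm_num
        · exact Real.one_le_rpow hp1 (by norm_num)
      · refine (hg.primePowBound p (k + 1) hp (by omega)).trans ?_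
        gcongr <;> omega
    exact (abs_sub _ _).trans (by linarith)
  refine ⟨hmul, fun p hp => ?_, hb, fun p hp => ?_⟩
  · have := moebius_mul_apply_prime_pow_succ g hp 0
    rwa [zero_add, pow_one, pow_zero, hg.apply_prime p hp, hg.isMultiplicative.map_one] at this
  · have hp1 : (1 : ℝ) < p := by exact_mod_cast hp.one_lt
    have hu := hg.primePowBound.summable_div hp
    have hv := hb.summable_div hp
    have hstep : ∀ k : ℕ, ((moebius : ArithmeticFunction ℝ) * g) (p ^ (k + 1))
        / ((p ^ (k + 1) : ℕ) : ℝ) = g (p ^ (k + 1)) / ((p ^ (k + 1) : ℕ) : ℝ)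
          - (g (p ^ k) / ((p ^ k : ℕ) : ℝ)) * (p : ℝ)⁻¹ := fun k => by
      rw [moebius_mul_apply_prime_pow_succ g hp k]
      push_cast
      field_simp
      ring
    have hpos := hg.factor_pos p hp
    rw [hv.tsum_eq_zero_add]
    simp only [hstep]
    rw [((summable_nat_add_iff 1).2 hu).tsum_sub (hu.mul_right _), tsum_mul_right]
    have h0 : ((moebius : ArithmeticFunction ℝ) * g) (p ^ 0) / ((p ^ 0 : ℕ) : ℝ)
        = g (p ^ 0) / ((p ^ 0 : ℕ) : ℝ) := by
      rw [pow_zero, hmul.map_one, hg.isMultiplicative.map_one]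
    rw [h0, ← add_sub_assoc, ← hu.tsum_eq_zero_add]
    have : (p : ℝ)⁻¹ < 1 := inv_lt_one_of_one_lt₀ hp1
    nlinarith

/-- The series of a nonnegative multiplicative function converges as soon as its Euler factors
are `1 + O(b p)` with `∑ b p` finite. -/
theorem summable_of_eulerFactors_le {F b : ℕ → ℝ} (hF : ∀ n, 0 ≤ F n) (hF0 : F 0 = 0)
    (hF1 : F 1 = 1) (hmul : ∀ {m n : ℕ}, m.Coprime n → F (m * n) = F m * F n)
    (hs : ∀ {p : ℕ}, p.Prime → Summable fun k : ℕ => F (p ^ k)) (hb : Summable b)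
    (hb0 : ∀ n, 0 ≤ b n)
    (hle : ∀ p : ℕ, p.Prime → ∑' k : ℕ, F (p ^ k) ≤ 1 + b p) : Summable F := by
  refine summable_of_sum_range_le (c := Real.exp (∑' n, b n)) hF fun N => ?_
  obtain ⟨h1, h2⟩ := EulerProduct.summable_and_hasSum_smoothNumbers_prod_primesBelow_tsum
    hF1 hmul (fun hp => (hs hp).norm) N
  have h3 : ∑ n ∈ Finset.range N, F n = ∑ n ∈ (Finset.range N).filter (0 < ·), F n := by
    refine (Finset.sum_filter_of_ne fun n _ hn => ?_).symm
    rcases Nat.eq_zero_or_pos n with rfl | h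
    · exact absurd hF0 hn
    · exact h
  have hmem : ∀ n ∈ (Finset.range N).filter (0 < ·), n ∈ N.smoothNumbers := fun n hn => by
    rw [Finset.mem_filter, Finset.mem_range] at hn
    exact Nat.mem_smoothNumbers_of_lt hn.2 hn.1
  calc ∑ n ∈ Finset.range N, F n
      = ∑ n ∈ (Finset.range N).filter (0 < ·), Set.indicator N.smoothNumbers F n := by
        rw [h3]
        exact Finset.sum_congr rfl fun n hn => (Set.indicator_of_mem (hmem n hn) F).symm
    _ ≤ ∏ p ∈ N.primesBelow, ∑' k : ℕ, F (p ^ k) :=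
        sum_le_hasSum _ (fun n _ => Set.indicator_nonneg (fun n _ => hF n) n)
          ((hasSum_subtype_iff_indicator (f := F)).1 h2)
    _ ≤ ∏ p ∈ N.primesBelow, Real.exp (b p) := by
        refine Finset.prod_le_prod (fun p _ => tsum_nonneg fun k => hF _) fun p hp => ?_
        refine (hle p (Nat.prime_of_mem_primesBelow hp)).trans ?_
        rw [add_comm]
        exact Real.add_one_le_exp _
    _ = Real.exp (∑ p ∈ N.primesBelow, b p) := (Real.exp_sum _ _).symm
    _ ≤ Real.exp (∑' n, b n) := Real.exp_le_exp.2 (hb.sum_le_tsum _ fun n _ => hb0 n)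

theorem summable_rpow_neg_excess : Summable fun n : ℕ => (n : ℝ) ^ (-(47 / 42) : ℝ) :=
  Real.summable_nat_rpow.2 (by norm_num)

theorem EulerData.summable {h : ArithmeticFunction ℝ} {C : ℝ} (hh : EulerData h 0 C) :
    Summable fun n : ℕ => |h n| * (n : ℝ) ^ (-(11 / 12) : ℝ) := by
  obtain ⟨T, hT0, hT⟩ := hh.primePowBound.exists_tail_bound
  refine summable_of_eulerFactors_le (b := fun n => T * (n : ℝ) ^ (-(47 / 42) : ℝ))
    (fun n => by positivity) (by simp) (by simp [hh.isMultiplicative.map_one])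
    (fun {m n} hmn => ?_) (fun hp => hh.primePowBound.summable le_rfl hp)
    (summable_rpow_neg_excess.mul_left T) (fun n => by positivity) fun p hp => ?_
  · rw [hh.isMultiplicative.map_mul_of_coprime hmn, abs_mul, Nat.cast_mul,
      Real.mul_rpow (by positivity) (by positivity)]
    ring
  · have hs := hh.primePowBound.summable (s := 11 / 12) le_rfl hp
    rw [← hs.sum_add_tsum_nat_add 2, Finset.sum_range_succ, Finset.sum_range_one, pow_zero,
      pow_one, hh.apply_prime p hp, hh.isMultiplicative.map_one]
    simpa using (hT _ le_rfl p hp).2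

theorem EulerData.tsum_div_ne_zero {h : ArithmeticFunction ℝ} {C : ℝ} (hh : EulerData h 0 C) :
    ∑' n : ℕ, h n / n ≠ 0 := by
  obtain ⟨T, hT0, hT⟩ := hh.primePowBound.exists_tail_bound
  have hsum : Summable fun n : ℕ => ‖h n / n‖ := by
    have := summable_mul_eval_log (by norm_num) hh.summable 1
    simp only [Polynomial.eval_one, mul_one] at this
    exact this.norm
  have hprod := EulerProduct.eulerProduct_hasProd (f := fun n : ℕ => h n / n)
    (by simp [hh.isMultiplicative.map_one])
    (fun {m n} hmn => by
      rw [hh.isMultiplicative.map_mul_of_coprime hmn, Nat.cast_mul, mul_div_mul_comm])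
    hsum (by simp)
  rw [← hprod.tprod_eq]
  have htail : ∀ p : ℕ, p.Prime → |∑' k : ℕ, h (p ^ k) / ((p ^ k : ℕ) : ℝ) - 1|
      ≤ T * (p : ℝ) ^ (-(47 / 42) : ℝ) := fun p hp => by
    have hs := hh.primePowBound.summable_div hp
    obtain ⟨h1, h2⟩ := hT 1 (by norm_num) p hp
    rw [← hs.sum_add_tsum_nat_add 2, Finset.sum_range_succ, Finset.sum_range_one, pow_zero,
      pow_one, hh.apply_prime p hp, hh.isMultiplicative.map_one]
    rw [Nat.cast_one, div_one, zero_div, add_zero, add_sub_cancel_left]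
    refine le_trans ?_ h2
    rw [← Real.norm_eq_abs]
    refine tsum_of_norm_bounded h1.hasSum fun k => le_of_eq ?_
    rw [Real.rpow_neg_one, norm_div, Real.norm_eq_abs, RCLike.norm_natCast, div_eq_mul_inv]
  have hne := tprod_one_add_ne_zero_of_summable (R := ℝ) (ι := Nat.Primes)
    (f := fun p => ∑' k : ℕ, h ((p : ℕ) ^ k) / (((p : ℕ) ^ k : ℕ) : ℝ) - 1)
    (fun p => by
      rw [add_sub_cancel]
      exact (hh.factor_pos p p.2).ne')
    (by
      refine Summable.of_nonneg_of_le (fun p => norm_nonneg _) (fun p => htail p p.2) ?_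
      exact (Nat.Primes.summable_rpow.2 (by norm_num)).mul_left T)
  simpa only [add_sub_cancel] using hne

/-- The number of orders of `ℤ^4` of index `n`, as a real arithmetic function. -/
noncomputable def orderCount : ArithmeticFunction ℝ :=
  ⟨fun n => if n = 0 then 0 else subringCount (Fin 4 → ℤ) n, if_pos rfl⟩

theorem orderCount_apply {n : ℕ} (hn : n ≠ 0) :
    orderCount n = subringCount (Fin 4 → ℤ) n := if_neg hn

theorem eulerData_orderCount : EulerData orderCount 6 8 := by
  have hmul : orderCount.IsMultiplicative := by
    refine ArithmeticFunction.IsMultiplicative.iff_ne_zero.2 ⟨?_, fun {m n} hm hn hmn => ?_⟩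
    · rw [orderCount_apply one_ne_zero, subringCount_one, Nat.cast_one]
    · rw [orderCount_apply hm, orderCount_apply hn, orderCount_apply (mul_ne_zero hm hn),
        subringCount_mul hm hn hmn, Nat.cast_mul]
  have hpow : ∀ p k : ℕ, p.Prime → orderCount (p ^ k) = subringCount (Fin 4 → ℤ) (p ^ k) :=
    fun p k hp => orderCount_apply (pow_ne_zero k hp.ne_zero)
  have hb : PrimePowBound orderCount 8 := fun p k hp hk => by
    have hp1 : (1 : ℝ) ≤ p := by exact_mod_cast hp.one_lt.le
    rw [hpow p k hp, Nat.abs_cast]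
    calc (subringCount (Fin 4 → ℤ) (p ^ k) : ℝ)
        ≤ ((8 * (k + 1) ^ 2 * p ^ (6 * k / 7 - 1) : ℕ) : ℝ) := by
          exact_mod_cast subringCount_prime_pow_le hp hk
      _ = 8 * ((k : ℝ) + 1) ^ 2 * (p : ℝ) ^ (((6 * k / 7 - 1 : ℕ) : ℝ)) := by
          rw [Real.rpow_natCast]; push_cast; ring
      _ ≤ _ := by
          refine mul_le_mul_of_nonneg_left (Real.rpow_le_rpow_of_exponent_le hp1 ?_)
            (by positivity)
          rw [Nat.cast_sub (by omega), Nat.cast_one]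
          have := Nat.cast_div_le (α := ℝ) (m := 6 * k) (n := 7)
          push_cast at this
          linarith
  refine ⟨hmul, fun p hp => ?_, hb, fun p hp => ?_⟩
  · rw [orderCount_apply hp.ne_zero, subringCount_prime hp]; norm_num
  · refine (hb.summable_div hp).tsum_pos (fun k => ?_) 0 ?_
    · rw [hpow p k hp]; positivity
    · rw [pow_zero, hmul.map_one]; norm_num

/-- Removing six zeta factors from the order count leaves a function with absolutely convergent
Dirichlet series to the left of `1` and nonzero value at `1`. -/
theorem exists_orderCount_eq_mul_zeta_pow :
    ∃ (h : ArithmeticFunction ℝ) (C : ℝ), EulerData h 0 C ∧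
      orderCount = h * (ArithmeticFunction.zeta : ArithmeticFunction ℝ) ^ 6 := by
  have h6 := eulerData_orderCount
  have h5 := h6.moebius_mul (by norm_num)
  have h4 := h5.moebius_mul (by norm_num)
  have h3 := h4.moebius_mul (by norm_num)
  have h2 := h3.moebius_mul (by norm_num)
  have h1 := h2.moebius_mul (by norm_num)
  have h0 := h1.moebius_mul (by norm_num)
  rw [show (6 - 1 - 1 - 1 - 1 - 1 - 1 : ℝ) = 0 by norm_num] at h0
  refine ⟨_, _, h0, ?_⟩
  have hμ := ArithmeticFunction.coe_moebius_mul_coe_zeta (R := ℝ)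
  simp only [← mul_assoc]
  calc orderCount
      = ((ArithmeticFunction.moebius : ArithmeticFunction ℝ) *
          (ArithmeticFunction.zeta : ArithmeticFunction ℝ)) ^ 6 * orderCount := by
        rw [hμ, one_pow, one_mul]
    _ = _ := by ring

/-- There is a real polynomial `P₄` of degree `5` such that for every `ε > 0`,
`N₄(B) = B · P₄(log B) + O_ε(B^(11/12 + ε))` as `B → ∞`. -/
theorem stmt8 :
    ∃ P : Polynomial ℝ, P.degree = 5 ∧
      ∀ ε : ℝ, 0 < ε → ∃ C : ℝ, 0 < C ∧ ∀ᶠ B : ℝ in Filter.atTop,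
        |(numOrdersZ 4 B : ℝ) - B * P.eval (Real.log B)| ≤ C * B ^ (11 / 12 + ε) := by
  obtain ⟨h, K, hh, hcount⟩ := exists_orderCount_eq_mul_zeta_pow
  obtain ⟨P, hP0, hPdeg, hP⟩ := exists_hasMainTerm_zeta_pow 5
  rw [show (1 - 1 / (2 * (((5 : ℕ) : ℝ) + 1)) : ℝ) = 11 / 12 by norm_num] at hP
  obtain ⟨Q, hQdeg, hQcoeff, C, hC⟩ := hP.mul_of_summable (by norm_num) hh.summable
  rw [hPdeg] at hQdeg hQcoeff
  have hQ5 : Q.coeff 5 ≠ 0 := by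
    rw [hQcoeff]
    exact mul_ne_zero (Polynomial.leadingCoeff_ne_zero.2 hP0) hh.tsum_div_ne_zero
  refine ⟨Q, ?_, fun ε hε => ⟨|C| + 1, by positivity, ?_⟩⟩
  · exact le_antisymm (Polynomial.degree_le_of_natDegree_le hQdeg)
      (Polynomial.le_degree_of_ne_zero hQ5)
  filter_upwards [Filter.eventually_ge_atTop 1] with B hB
  have hN : (numOrdersZ 4 B : ℝ) = ∑ n ∈ Finset.Ioc 0 ⌊B⌋₊, orderCount n := by
    rw [numOrdersZ, numOrders_eq_sum (zero_le_one.trans hB), Nat.cast_sum]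
    exact Finset.sum_congr rfl fun n hn =>
      (orderCount_apply (Finset.mem_Ioc.1 hn).1.ne').symm
  rw [hN, hcount]
  refine (hC B hB).trans (mul_le_mul ((le_abs_self C).trans (by linarith))
    (Real.rpow_le_rpow_of_exponent_le hB (by linarith)) (by positivity) (by positivity))
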